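/- arXiv:0902.4495 — 2 statements merged into one kernel-verified Lean document; each statement's English description precedes it below -/
import Mathlib

section
/- Let Q be a Feller Markov kernel on a Polish space X and let d be a continuous metric with values in [0,1] which generates the topology of X and is contracting for Q. Then there exists a measurable map (y,y') ↦ Γ_{y,y'} with Γ_{y,y'} ∈ C(Q_[∞]δ_y, Q_[∞]δ_{y'}) for every (y,y') ∈ X×X, such that for every ε > 0 and every x ∈ X there exists a neighbourhood U of x with inf_{y,y' ∈ U} Γ_{y,y'}(D) ≥ 1 − ε. -/
open MeasureTheory ProbabilityTheory Filter Topology BoundedContinuousFunction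
open scoped ENNReal NNReal

noncomputable section

/-- A coupling of two measures: a measure on the product with the given marginals. -/
def IsCoupling {α β : Type*} [MeasurableSpace α] [MeasurableSpace β]
    (π : Measure (α × β)) (μ : Measure α) (ν : Measure β) : Prop :=
  π.map Prod.fst = μ ∧ π.map Prod.snd = ν

/-- The lift of a distance-like function `d` to probability measures. -/
def liftDist {α : Type*} [MeasurableSpace α] (d : α → α → ℝ) (μ ν : Measure α) : ℝ≥0∞ :=
  sInf {r : ℝ≥0∞ | ∃ π : Measure (α × α), IsCoupling π μ ν ∧
    r = ∫⁻ p, ENNReal.ofReal (d p.1 p.2) ∂π}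

/-- `m` is the law on the sequence space of the Markov chain with transition kernel `P`
and initial distribution `μ` (i.e. `P_[∞] μ`), characterised through its
finite-dimensional distributions. -/
def IsTrajLaw {Y : Type*} [MeasurableSpace Y] (P : Kernel Y Y) (μ : Measure Y)
    (m : Measure (ℕ → Y)) : Prop :=
  IsProbabilityMeasure m ∧
  m.map (fun ω => ω 0) = μ ∧
  ∀ n : ℕ, m.map (fun ω => ((fun i : Fin (n + 1) => ω i), ω (n + 1))) =
    (m.map (fun ω => (fun i : Fin (n + 1) => ω i))).bind
      (fun v => (P (v (Fin.last n))).map (fun y => (v, y)))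

/-- The diagonal at infinity with respect to a distance function `d`. -/
def diagInfD {X : Type*} (d : X → X → ℝ) : Set ((ℕ → X) × (ℕ → X)) :=
  {p | Tendsto (fun n => d (p.1 n) (p.2 n)) atTop (nhds 0)}


/-- The one-step extension of a law on finite paths, written as a composition-product. -/
lemma bind_map_prodMk_eq_compProd {V Y : Type*} [MeasurableSpace V] [MeasurableSpace Y]
    (P : Kernel Y Y) [IsMarkovKernel P] (μ : Measure V) [SFinite μ] {k : V → Y}
    (hk : Measurable k) :
    μ.bind (fun v => (P (k v)).map (fun y => (v, y))) = μ ⊗ₘ P.comap k hk := by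
  have key : ∀ v, (P (k v)).map (fun y => (v, y)) = (Kernel.id ×ₖ P.comap k hk) v := by
    intro v
    rw [Kernel.prod_apply, Kernel.id_apply, Measure.dirac_prod, Kernel.comap_apply]
  simp_rw [key, Measure.compProd_eq_comp_prod]

lemma isTrajLaw_iff {Y : Type*} [MeasurableSpace Y] (P : Kernel Y Y) [IsMarkovKernel P]
    (μ : Measure Y) (m : Measure (ℕ → Y)) :
    IsTrajLaw P μ m ↔ IsProbabilityMeasure m ∧ m.map (fun ω => ω 0) = μ ∧
      ∀ (n : ℕ) (s : Set ((Fin (n + 1) → Y) × Y)), MeasurableSet s →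
        m {ω | ((fun i : Fin (n + 1) => ω i), ω (n + 1)) ∈ s} =
          ∫⁻ ω, P (ω n) {y | ((fun i : Fin (n + 1) => ω i), y) ∈ s} ∂m := by
  refine and_congr_right fun hm => and_congr_right fun _ => forall_congr' fun n => ?_
  rw [bind_map_prodMk_eq_compProd P _ (measurable_pi_apply (Fin.last n)), Measure.ext_iff]
  refine forall_congr' fun s => forall_congr' fun hs => ?_
  rw [Measure.map_apply (by fun_prop) hs, Measure.compProd_apply hs,
    lintegral_map (Kernel.measurable_kernel_prodMk_left hs) (by fun_prop)]
  simp [Set.preimage]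

/-- Integral form of the Markov property. -/
lemma IsTrajLaw.lintegral_succ {Y : Type*} [MeasurableSpace Y] {P : Kernel Y Y}
    [IsMarkovKernel P] {μ : Measure Y} {m : Measure (ℕ → Y)} (h : IsTrajLaw P μ m) (n : ℕ)
    {f : (Fin (n + 1) → Y) × Y → ℝ≥0∞} (hf : Measurable f) :
    ∫⁻ ω, f ((fun i => ω i), ω (n + 1)) ∂m =
      ∫⁻ ω, ∫⁻ y, f ((fun i => ω i), y) ∂(P (ω n)) ∂m := by
  have := h.1
  have h2 := h.2.2 n
  rw [bind_map_prodMk_eq_compProd P _ (measurable_pi_apply (Fin.last n))] at h2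
  rw [← lintegral_map (g := fun ω : ℕ → Y => ((fun i : Fin (n + 1) => ω i), ω (n + 1)))
    hf (by fun_prop), h2, Measure.lintegral_compProd hf, lintegral_map _ (by fun_prop)]
  · simp
  · exact hf.lintegral_kernel_prod_right'

/-- Functoriality of trajectory laws: a map intertwining the kernels maps trajectory laws to
trajectory laws. -/
lemma IsTrajLaw.map {Z Y : Type*} [MeasurableSpace Z] [MeasurableSpace Y] {P : Kernel Z Z}
    [IsMarkovKernel P] {Q : Kernel Y Y} [IsMarkovKernel Q] {φ : Z → Y} (hφ : Measurable φ)
    (hPQ : ∀ z, (P z).map φ = Q (φ z)) {μ : Measure Z} {m : Measure (ℕ → Z)}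
    (h : IsTrajLaw P μ m) : IsTrajLaw Q (μ.map φ) (m.map (fun ω n => φ (ω n))) := by
  have := h.1
  have hφ' : Measurable (fun (ω : ℕ → Z) n => φ (ω n)) := by fun_prop
  rw [isTrajLaw_iff] at h ⊢
  refine ⟨Measure.isProbabilityMeasure_map hφ'.aemeasurable, ?_, fun n s hs => ?_⟩
  · rw [← h.2.1, Measure.map_map (by fun_prop) hφ', Measure.map_map hφ (by fun_prop)]
    rfl
  · have hm : MeasurableSet {ω : ℕ → Y | ((fun i : Fin (n + 1) => ω i), ω (n + 1)) ∈ s} :=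
      hs.preimage (by fun_prop)
    rw [Measure.map_apply hφ' hm, lintegral_map _ hφ']
    · have hs' : MeasurableSet {p : (Fin (n + 1) → Z) × Z | ((fun i => φ (p.1 i)), φ p.2) ∈ s} :=
        hs.preimage (by fun_prop)
      refine (h.2.2 n _ hs').trans (lintegral_congr fun ω => ?_)
      have hm' : MeasurableSet {y : Y | ((fun i : Fin (n + 1) => φ (ω i)), y) ∈ s} :=
        hs.preimage (by fun_prop)
      rw [← hPQ, Measure.map_apply hφ hm']
      rfl
    · exact Kernel.measurable_kernel_prodMk_left (κ := Q.comap (fun ω : ℕ → Y => ω n)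
        (measurable_pi_apply n)) (hs.preimage (t := s)
        (f := fun p : (ℕ → Y) × Y => ((fun i : Fin (n + 1) => p.1 i), p.2)) (by fun_prop))

/-- Existence of trajectory laws, depending measurably on the starting point. -/
lemma exists_kernel_isTrajLaw {Z : Type*} [MeasurableSpace Z] (P : Kernel Z Z)
    [IsMarkovKernel P] :
    ∃ T : Kernel Z (ℕ → Z), IsMarkovKernel T ∧ ∀ z, IsTrajLaw P (Measure.dirac z) (T z) := by
  let κ : (n : ℕ) → Kernel ((i : Finset.Iic n) → Z) Z := fun n =>
    P.comap (fun v => v ⟨n, Finset.mem_Iic.2 le_rfl⟩) (by fun_prop)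
  have : ∀ n, IsMarkovKernel (κ n) := fun n => by dsimp only [κ]; infer_instance
  let T : Kernel Z (ℕ → Z) :=
    (Kernel.traj (X := fun _ => Z) κ 0).comap (fun z _ => z) (by fun_prop)
  have hT : IsMarkovKernel T := by dsimp only [T]; infer_instance
  refine ⟨T, hT, fun z => (isTrajLaw_iff _ _ _).2 ⟨inferInstance, ?_, fun n s hs => ?_⟩⟩
  · have h0 := Kernel.traj_map_frestrictLe_apply (X := fun _ => Z) (κ := κ) 0 0 (fun _ => z)
    let e : ((i : Finset.Iic 0) → Z) → Z := fun v => v ⟨0, Finset.mem_Iic.2 le_rfl⟩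
    have he : Measurable e := measurable_pi_apply _
    rw [Kernel.partialTraj_self, Kernel.id_apply] at h0
    have h1 : (fun ω : ℕ → Z => ω 0) = e ∘ Preorder.frestrictLe 0 := rfl
    have h2 : T z = Kernel.traj (X := fun _ => Z) κ 0 (fun _ => z) := rfl
    rw [h1, h2, ← Measure.map_map he (by fun_prop), h0]
    exact Measure.map_dirac' he _
  · have h0 := Kernel.partialTraj_compProd_eq_map_traj (X := fun _ => Z) (κ := κ)
      (Nat.zero_le n) (x₀ := fun _ => z)
    let e : ((i : Finset.Iic n) → Z) → Fin (n + 1) → Z := fun v i =>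
      v ⟨i, Finset.mem_Iic.2 (Nat.lt_succ_iff.1 i.2)⟩
    have he : Measurable e := by fun_prop
    have hs' : MeasurableSet {p : ((i : Finset.Iic n) → Z) × Z | (e p.1, p.2) ∈ s} :=
      hs.preimage (by fun_prop)
    have h1 := Measure.ext_iff.1 h0 _ hs'
    rw [Measure.map_apply (by fun_prop) hs', Measure.compProd_apply hs',
      ← Kernel.traj_map_frestrictLe_apply,
      lintegral_map (Kernel.measurable_kernel_prodMk_left hs') (by fun_prop)] at h1
    exact h1.symm

/-- If the expected cost contracts by a factor `a` whenever the current cost is smaller than `1`,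
then the cost converges to `0` along the chain with probability at least `1 - c z / (1 - a)`. -/
lemma IsTrajLaw.one_sub_le_measure_tendsto {Z : Type*} [MeasurableSpace Z] {P : Kernel Z Z}
    [IsMarkovKernel P] {c : Z → ℝ≥0∞} (hc : Measurable c) {a : ℝ≥0∞}
    (hstep : ∀ z, c z < 1 → ∫⁻ w, c w ∂(P z) ≤ a * c z) {z : Z} {m : Measure (ℕ → Z)}
    (hm : IsTrajLaw P (Measure.dirac z) m) :
    1 - (1 - a)⁻¹ * c z ≤ m {ω | Tendsto (fun n => c (ω n)) atTop (𝓝 0)} := by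
  have := hm.1
  let B : ℕ → Set (ℕ → Z) := fun n => {ω | ∀ i : Fin n, c (ω i) < 1}
  have hB : ∀ n, MeasurableSet (B n) := fun n => by
    simp only [B, Set.ofPred_forall]
    exact MeasurableSet.iInter fun i => measurableSet_lt (by fun_prop) measurable_const
  let g : ℕ → (ℕ → Z) → ℝ≥0∞ := fun n => (B n).indicator fun ω => c (ω n)
  have hg : ∀ n, Measurable (g n) := fun n =>
    Measurable.indicator (by fun_prop) (hB n)
  have h_zero : ∫⁻ ω, g 0 ω ∂m = c z := by
    have : g 0 = fun ω => c (ω 0) := by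
      ext ω
      exact Set.indicator_of_mem (fun i => i.elim0) _
    rw [this, ← lintegral_map hc (by fun_prop), hm.2.1, lintegral_dirac' _ hc]
  have h_succ : ∀ n, ∫⁻ ω, g (n + 1) ω ∂m ≤ a * ∫⁻ ω, g n ω ∂m := by
    intro n
    let A : Set (Fin (n + 1) → Z) := {v | ∀ i, c (v i) < 1}
    have hA : MeasurableSet A := by
      simp only [A, Set.ofPred_forall]
      exact MeasurableSet.iInter fun i => measurableSet_lt (by fun_prop) measurable_const
    let f : (Fin (n + 1) → Z) × Z → ℝ≥0∞ := (Prod.fst ⁻¹' A).indicator fun p => c p.2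
    have hf : Measurable f := Measurable.indicator (by fun_prop) (measurable_fst hA)
    rw [← lintegral_const_mul _ (hg n)]
    refine (hm.lintegral_succ n hf).trans_le (lintegral_mono fun ω => ?_)
    by_cases hω : (fun i : Fin (n + 1) => ω i) ∈ A
    · have h1 : ∀ y, f ((fun i => ω i), y) = c y := fun y =>
        Set.indicator_of_mem (s := Prod.fst ⁻¹' A) hω _
      have hωB : ω ∈ B n := fun i => hω i.castSucc
      have h2 : g n ω = c (ω n) := Set.indicator_of_mem hωB _
      simp only [h1, h2]
      exact hstep _ (hω (Fin.last n))
    · have h1 : ∀ y, f ((fun i => ω i), y) = 0 := fun y =>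
        Set.indicator_of_notMem (s := Prod.fst ⁻¹' A) hω _
      simp [h1]
  have h_pow : ∀ n, ∫⁻ ω, g n ω ∂m ≤ a ^ n * c z := by
    intro n
    induction n with
    | zero => simp [h_zero]
    | succ n ih =>
      refine (h_succ n).trans ?_
      rw [pow_succ', mul_assoc]
      gcongr
  have h_sum : ∫⁻ ω, ∑' n, g n ω ∂m ≤ (1 - a)⁻¹ * c z := by
    rw [lintegral_tsum fun n => (hg n).aemeasurable, ← ENNReal.tsum_geometric,
      ← ENNReal.tsum_mul_right]
    exact ENNReal.tsum_le_tsum h_pow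
  have hS : Measurable fun ω => ∑' n, g n ω := Measurable.tsum hg
  have h_sub : {ω | 1 ≤ ∑' n, g n ω}ᶜ ⊆ {ω | Tendsto (fun n => c (ω n)) atTop (𝓝 0)} := by
    intro ω hω
    have hlt : ∑' n, g n ω < 1 := not_le.1 hω
    have hmem : ∀ n, ω ∈ B n := by
      intro n
      induction n with
      | zero => exact fun i => i.elim0
      | succ n ih =>
        intro i
        rcases Fin.eq_castSucc_or_eq_last i with ⟨j, rfl⟩ | rfl
        · exact ih j
        · have : g n ω = c (ω n) := Set.indicator_of_mem ih _
          exact (this ▸ ENNReal.le_tsum n : c (ω n) ≤ _).trans_lt hlt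
    have heq : (fun n => c (ω n)) = fun n => g n ω :=
      funext fun n => (Set.indicator_of_mem (hmem n) fun ω => c (ω n)).symm
    simp only [Set.mem_ofPred_eq, heq]
    exact ENNReal.tendsto_atTop_zero_of_tsum_ne_top hlt.ne_top
  refine le_trans ?_ (measure_mono h_sub)
  rw [prob_compl_eq_one_sub (measurableSet_le measurable_const hS)]
  gcongr
  simpa using (mul_meas_ge_le_lintegral hS 1).trans h_sum

section CompletedDensity

variable {α β : Type*} [MeasurableSpace α] [MeasurableSpace β]

/-- Completion of the density `f` of a subcoupling of `μ` and `ν` to the density of a coupling,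
by adding a multiple of the product of the missing marginals. -/
def completedDensity (μ : Measure α) (ν : Measure β) (f : α × β → ℝ≥0∞) (p : α × β) : ℝ≥0∞ :=
  f p + (1 - ∫⁻ a, ∫⁻ b, f (a, b) ∂ν ∂μ)⁻¹ *
    ((1 - ∫⁻ b, f (p.1, b) ∂ν) * (1 - ∫⁻ a, f (a, p.2) ∂μ))

/-- `f` is the density of a subcoupling of `μ` and `ν`. -/
def IsSubcouplingDensity (μ : Measure α) (ν : Measure β) (f : α × β → ℝ≥0∞) : Prop :=
  (∀ᵐ a ∂μ, ∫⁻ b, f (a, b) ∂ν ≤ 1) ∧ ∀ᵐ b ∂ν, ∫⁻ a, f (a, b) ∂μ ≤ 1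

variable {μ : Measure α} {ν : Measure β} {f : α × β → ℝ≥0∞}

lemma IsSubcouplingDensity.swap (h : IsSubcouplingDensity μ ν f) :
    IsSubcouplingDensity ν μ (f ∘ Prod.swap) := ⟨h.2, h.1⟩

lemma IsSubcouplingDensity.mass_le_one [IsProbabilityMeasure μ]
    (h : IsSubcouplingDensity μ ν f) : ∫⁻ a, ∫⁻ b, f (a, b) ∂ν ∂μ ≤ 1 := by
  simpa using lintegral_mono_ae h.1

variable [IsProbabilityMeasure μ] [IsProbabilityMeasure ν]

lemma measurable_completedDensity (hf : Measurable f) :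
    Measurable (completedDensity μ ν f) := by
  have h1 : Measurable fun a => ∫⁻ b, f (a, b) ∂ν := hf.lintegral_prod_right'
  have h2 : Measurable fun b => ∫⁻ a, f (a, b) ∂μ := hf.lintegral_prod_left'
  unfold completedDensity
  fun_prop

lemma completedDensity_swap (hf : Measurable f) (p : α × β) :
    completedDensity ν μ (f ∘ Prod.swap) p.swap = completedDensity μ ν f p := by
  have : ∫⁻ b, ∫⁻ a, f (a, b) ∂μ ∂ν = ∫⁻ a, ∫⁻ b, f (a, b) ∂ν ∂μ :=
    lintegral_lintegral_swap (f := fun b a => f (a, b)) (hf.comp measurable_swap).aemeasurable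
  simp only [completedDensity, Function.comp_apply, Prod.swap_swap, Prod.fst_swap,
    Prod.snd_swap, Prod.swap_prod_mk, this]
  rw [mul_comm (1 - ∫⁻ a, f (a, p.2) ∂μ)]

lemma lintegral_one_sub_fst (hf : Measurable f) (h : IsSubcouplingDensity μ ν f) :
    ∫⁻ a, (1 - ∫⁻ b, f (a, b) ∂ν) ∂μ = 1 - ∫⁻ a, ∫⁻ b, f (a, b) ∂ν ∂μ := by
  rw [lintegral_sub hf.lintegral_prod_right' (ne_top_of_le_ne_top ENNReal.one_ne_top
    h.mass_le_one) h.1]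
  simp

lemma lintegral_one_sub_snd (hf : Measurable f) (h : IsSubcouplingDensity μ ν f) :
    ∫⁻ b, (1 - ∫⁻ a, f (a, b) ∂μ) ∂ν = 1 - ∫⁻ a, ∫⁻ b, f (a, b) ∂ν ∂μ := by
  rw [← lintegral_lintegral_swap (f := fun b a => f (a, b))
    (hf.comp measurable_swap).aemeasurable]
  exact lintegral_one_sub_fst (hf.comp measurable_swap) h.swap

lemma ae_lintegral_completedDensity (hf : Measurable f) (h : IsSubcouplingDensity μ ν f) :
    ∀ᵐ a ∂μ, ∫⁻ b, completedDensity μ ν f (a, b) ∂ν = 1 := by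
  have h1 : Measurable fun a => ∫⁻ b, f (a, b) ∂ν := hf.lintegral_prod_right'
  have h2 : Measurable fun b => ∫⁻ a, f (a, b) ∂μ := hf.lintegral_prod_left'
  have hF : ∀ a, ∫⁻ b, completedDensity μ ν f (a, b) ∂ν = ∫⁻ b, f (a, b) ∂ν +
      (1 - ∫⁻ a, ∫⁻ b, f (a, b) ∂ν ∂μ)⁻¹ * ((1 - ∫⁻ b, f (a, b) ∂ν) *
        (1 - ∫⁻ a, ∫⁻ b, f (a, b) ∂ν ∂μ)) := by
    intro a
    unfold completedDensity
    rw [lintegral_add_left (by fun_prop), lintegral_const_mul _ (by fun_prop)]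
    dsimp only
    rw [lintegral_const_mul _ (by fun_prop), lintegral_one_sub_snd hf h]
  rcases eq_or_ne (1 - ∫⁻ a, ∫⁻ b, f (a, b) ∂ν ∂μ) 0 with h0 | h0
  · have h3 := lintegral_one_sub_fst hf h
    rw [h0, lintegral_eq_zero_iff (by fun_prop)] at h3
    filter_upwards [h3, h.1] with a ha ha'
    rw [hF, h0]
    simpa using le_antisymm ha' (tsub_eq_zero_iff_le.1 ha)
  · filter_upwards [h.1] with a ha
    rw [hF, mul_left_comm, ENNReal.inv_mul_cancel h0
      (ne_top_of_le_ne_top ENNReal.one_ne_top tsub_le_self), mul_one,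
      add_tsub_cancel_of_le ha]

lemma map_fst_completedDensity (hf : Measurable f) (h : IsSubcouplingDensity μ ν f) :
    ((μ.prod ν).withDensity (completedDensity μ ν f)).map Prod.fst = μ := by
  have hm := measurable_completedDensity (μ := μ) (ν := ν) hf
  ext s hs
  rw [Measure.map_apply measurable_fst hs, withDensity_apply _ (measurable_fst hs),
    ← Set.prod_univ, ← Measure.prod_restrict, Measure.restrict_univ,
    lintegral_prod _ hm.aemeasurable,
    lintegral_congr_ae (ae_restrict_of_ae (ae_lintegral_completedDensity hf h))]
  simp

/-- Completing the density of a subcoupling yields a coupling. -/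
lemma isCoupling_completedDensity (hf : Measurable f) (h : IsSubcouplingDensity μ ν f) :
    IsCoupling ((μ.prod ν).withDensity (completedDensity μ ν f)) μ ν := by
  refine ⟨map_fst_completedDensity hf h, ?_⟩
  have hm := measurable_completedDensity (μ := μ) (ν := ν) hf
  ext s hs
  rw [Measure.map_apply measurable_snd hs, withDensity_apply _ (measurable_snd hs),
    ← Set.univ_prod, ← Measure.prod_restrict, Measure.restrict_univ,
    lintegral_prod_symm _ hm.aemeasurable,
    lintegral_congr_ae (g := fun _ => 1) (ae_restrict_of_ae ?_)]
  · simp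
  · filter_upwards [ae_lintegral_completedDensity (hf.comp measurable_swap) h.swap] with b hb
    rw [← hb]
    exact lintegral_congr fun a => (completedDensity_swap hf (a, b)).symm

/-- The cost of the completed coupling exceeds that of the subcoupling at most by the missing
mass. -/
lemma lintegral_completedDensity_le (hf : Measurable f) (h : IsSubcouplingDensity μ ν f)
    {c : α × β → ℝ≥0∞} (hc : Measurable c) (hc1 : ∀ p, c p ≤ 1) :
    ∫⁻ p, c p ∂(μ.prod ν).withDensity (completedDensity μ ν f) ≤
      ∫⁻ p, c p ∂(μ.prod ν).withDensity f + (1 - ∫⁻ a, ∫⁻ b, f (a, b) ∂ν ∂μ) := by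
  have hm := measurable_completedDensity (μ := μ) (ν := ν) hf
  have h1 : Measurable fun a => ∫⁻ b, f (a, b) ∂ν := hf.lintegral_prod_right'
  have h2 : Measurable fun b => ∫⁻ a, f (a, b) ∂μ := hf.lintegral_prod_left'
  set k := 1 - ∫⁻ a, ∫⁻ b, f (a, b) ∂ν ∂μ with hk
  rw [lintegral_withDensity_eq_lintegral_mul _ hm hc,
    lintegral_withDensity_eq_lintegral_mul _ hf hc]
  calc ∫⁻ p, (completedDensity μ ν f * c) p ∂μ.prod ν
      ≤ ∫⁻ p, (f * c) p + k⁻¹ * ((1 - ∫⁻ b, f (p.1, b) ∂ν) * (1 - ∫⁻ a, f (a, p.2) ∂μ))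
          ∂μ.prod ν := by
        refine lintegral_mono fun p => ?_
        simp only [Pi.mul_apply, completedDensity, add_mul]
        exact add_le_add le_rfl (mul_le_of_le_one_right' (hc1 p))
    _ = ∫⁻ p, (f * c) p ∂μ.prod ν + k⁻¹ * (k * k) := by
        rw [lintegral_add_left (by fun_prop), lintegral_const_mul _ (by fun_prop),
          lintegral_prod_mul (f := fun a => 1 - ∫⁻ b, f (a, b) ∂ν)
            (g := fun b => 1 - ∫⁻ a, f (a, b) ∂μ) (by fun_prop) (by fun_prop),
          lintegral_one_sub_fst hf h, lintegral_one_sub_snd hf h]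
    _ ≤ ∫⁻ p, (f * c) p ∂μ.prod ν + k := by
        gcongr
        rw [← mul_assoc]
        exact mul_le_of_le_one_left' (ENNReal.inv_mul_le_one k)

end CompletedDensity

/-- A finitely supported function on `ℕ × ℕ` with values in the multiples of `1 / (n + 1)`. -/
def gridDensity (n : ℕ) (v : ℕ × ℕ →₀ ℕ) (p : ℕ × ℕ) : ℝ≥0∞ := v p / (n + 1 : ℕ)

lemma IsCoupling.isProbabilityMeasure {α β : Type*} [MeasurableSpace α] [MeasurableSpace β]
    {μ : Measure α} {ν : Measure β} {π : Measure (α × β)} [IsProbabilityMeasure μ]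
    (hπ : IsCoupling π μ ν) : IsProbabilityMeasure π := by
  refine ⟨?_⟩
  rw [← Set.preimage_univ (f := Prod.fst), ← Measure.map_apply measurable_fst .univ, hπ.1]
  exact measure_univ

lemma absolutelyContinuous_prod_of_isCoupling {α β : Type*} [MeasurableSpace α]
    [MeasurableSpace β] [Countable α] [Countable β] [MeasurableSingletonClass α]
    [MeasurableSingletonClass β] {μ : Measure α} {ν : Measure β} [SFinite μ] [SFinite ν]
    {π : Measure (α × β)} (hπ : IsCoupling π μ ν) : π ≪ μ.prod ν := by
  refine Measure.AbsolutelyContinuous.mk fun s _ hs => ?_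
  rw [← Set.biUnion_of_singleton s, measure_biUnion_null_iff s.to_countable] at hs ⊢
  rintro ⟨a, b⟩ hab
  have := hs _ hab
  rw [← Set.singleton_prod_singleton, Measure.prod_prod, mul_eq_zero, ← hπ.1, ← hπ.2,
    Measure.map_apply measurable_fst (measurableSet_singleton a),
    Measure.map_apply measurable_snd (measurableSet_singleton b)] at this
  rcases this with h | h
  · exact measure_mono_null (by rintro _ rfl; rfl) h
  · exact measure_mono_null (by rintro _ rfl; rfl) h

/-- A coupling of measures on `ℕ` contains a subcoupling of almost full mass whose density takes
finitely many rational values. -/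
lemma exists_gridDensity_le {μ ν : Measure ℕ} [IsProbabilityMeasure μ] [IsProbabilityMeasure ν]
    {π : Measure (ℕ × ℕ)} (hπ : IsCoupling π μ ν) {δ : ℝ≥0∞} (hδ : δ ≠ 0) :
    ∃ n v, (μ.prod ν).withDensity (gridDensity n v) ≤ π ∧
      1 - ∫⁻ p, gridDensity n v p ∂μ.prod ν ≤ δ := by
  have : IsProbabilityMeasure π := hπ.isProbabilityMeasure
  let g := π.rnDeriv (μ.prod ν)
  have hg : (μ.prod ν).withDensity g = π :=
    Measure.withDensity_rnDeriv_eq _ _ (absolutelyContinuous_prod_of_isCoupling hπ)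
  have hg1 : ∫⁻ p, g p ∂μ.prod ν = 1 := by
    rw [← setLIntegral_univ, ← withDensity_apply' g, hg]
    exact measure_univ
  let v : ℕ → ℕ × ℕ →₀ ℕ := fun n =>
    Finsupp.onFinset (Finset.range n ×ˢ Finset.range n)
      (fun p => if p ∈ Finset.range n ×ˢ Finset.range n then ⌊(g p).toReal * (n + 1 : ℕ)⌋₊ else 0)
      (fun p hp => by by_contra h; simp [h] at hp)
  have hv_le : ∀ n p, gridDensity n (v n) p ≤ g p := by
    intro n p
    refine ENNReal.div_le_of_le_mul ?_
    by_cases hp : p ∈ Finset.range n ×ˢ Finset.range n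
    · have h1 : v n p = ⌊(g p).toReal * (n + 1 : ℕ)⌋₊ := if_pos hp
      rw [h1]
      calc ((⌊(g p).toReal * (n + 1 : ℕ)⌋₊ : ℕ) : ℝ≥0∞)
          = ENNReal.ofReal (⌊(g p).toReal * (n + 1 : ℕ)⌋₊ : ℝ) := by simp
        _ ≤ ENNReal.ofReal ((g p).toReal * (n + 1 : ℕ)) :=
            ENNReal.ofReal_le_ofReal (Nat.floor_le (by positivity))
        _ = ENNReal.ofReal (g p).toReal * (n + 1 : ℕ) := by
            rw [ENNReal.ofReal_mul (by positivity), ENNReal.ofReal_natCast]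
        _ ≤ g p * (n + 1 : ℕ) := by gcongr; exact ENNReal.ofReal_toReal_le
    · have h1 : v n p = 0 := if_neg hp
      simp [h1]
  have hv_tendsto : ∀ᵐ p ∂μ.prod ν,
      Tendsto (fun n => gridDensity n (v n) p) atTop (𝓝 (g p)) := by
    filter_upwards [Measure.rnDeriv_lt_top π (μ.prod ν)] with p hp
    have h1 : Tendsto (fun n : ℕ => (⌊(g p).toReal * (n + 1 : ℕ)⌋₊ : ℝ) / (n + 1 : ℕ)) atTop
        (𝓝 (g p).toReal) :=
      (tendsto_nat_floor_mul_div_atTop ENNReal.toReal_nonneg).comp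
        (tendsto_natCast_atTop_atTop.comp (tendsto_add_atTop_nat 1))
    have h2 := ENNReal.tendsto_ofReal h1
    rw [ENNReal.ofReal_toReal hp.ne] at h2
    refine h2.congr' ?_
    filter_upwards [eventually_gt_atTop (max p.1 p.2)] with n hn
    have h3 : v n p = ⌊(g p).toReal * (n + 1 : ℕ)⌋₊ :=
      if_pos (by simp only [Finset.mem_product, Finset.mem_range]; omega)
    rw [gridDensity, h3, ENNReal.ofReal_div_of_pos (by positivity), ENNReal.ofReal_natCast,
      ENNReal.ofReal_natCast]
  have hlim := tendsto_lintegral_of_dominated_convergence g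
    (fun n => measurable_of_countable (gridDensity n (v n)))
    (fun n => ae_of_all (μ.prod ν) (hv_le n)) (by rw [hg1]; exact ENNReal.one_ne_top) hv_tendsto
  rw [hg1] at hlim
  have hlim' := ENNReal.Tendsto.sub (tendsto_const_nhds (x := (1 : ℝ≥0∞))) hlim
    (Or.inl ENNReal.one_ne_top)
  rw [tsub_self] at hlim'
  obtain ⟨n, hn⟩ := (hlim'.eventually (gt_mem_nhds (pos_iff_ne_zero.2 hδ))).exists
  exact ⟨n, v n, hg ▸ withDensity_mono (ae_of_all _ (hv_le n)), hn.le⟩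

lemma IsCoupling.map_prodMap {α β α' β' : Type*} [MeasurableSpace α] [MeasurableSpace β]
    [MeasurableSpace α'] [MeasurableSpace β'] {μ : Measure α} {ν : Measure β}
    {π : Measure (α × β)} (hπ : IsCoupling π μ ν) {f : α → α'} {g : β → β'} (hf : Measurable f)
    (hg : Measurable g) : IsCoupling (π.map (Prod.map f g)) (μ.map f) (ν.map g) := by
  constructor
  · rw [Measure.map_map measurable_fst (hf.prodMap hg), ← hπ.1, Measure.map_map hf measurable_fst]
    rfl
  · rw [Measure.map_map measurable_snd (hf.prodMap hg), ← hπ.2, Measure.map_map hg measurable_snd]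
    rfl

/-- A density whose associated measure is dominated by a coupling is a subcoupling density. -/
lemma isSubcouplingDensity_of_le {α β : Type*} [MeasurableSpace α] [MeasurableSpace β]
    {μ : Measure α} {ν : Measure β} [IsProbabilityMeasure μ] [IsProbabilityMeasure ν]
    {π : Measure (α × β)} (hπ : IsCoupling π μ ν) {f : α × β → ℝ≥0∞} (hf : Measurable f)
    (hle : (μ.prod ν).withDensity f ≤ π) : IsSubcouplingDensity μ ν f := by
  constructor
  · refine ae_le_of_forall_setLIntegral_le_of_sigmaFinite hf.lintegral_prod_right'
      fun s hs _ => ?_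
    rw [setLIntegral_one]
    nth_rw 2 [← hπ.1]
    rw [Measure.map_apply measurable_fst hs]
    refine le_trans (le_of_eq ?_) (hle _)
    rw [withDensity_apply _ (measurable_fst hs), ← Set.prod_univ, ← Measure.prod_restrict,
      Measure.restrict_univ, lintegral_prod _ hf.aemeasurable]
  · refine ae_le_of_forall_setLIntegral_le_of_sigmaFinite hf.lintegral_prod_left'
      fun s hs _ => ?_
    rw [setLIntegral_one]
    nth_rw 2 [← hπ.2]
    rw [Measure.map_apply measurable_snd hs]
    refine le_trans (le_of_eq ?_) (hle _)
    rw [withDensity_apply _ (measurable_snd hs), ← Set.univ_prod, ← Measure.prod_restrict,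
      Measure.restrict_univ, lintegral_prod_symm _ hf.aemeasurable]

/-- A coupling can be approximated, with control of the cost, by a subcoupling whose density is
constant on the cells of a partition and takes finitely many rational values. -/
lemma exists_gridDensity_comp {X : Type*} [MeasurableSpace X] {μ ν : Measure X}
    [IsProbabilityMeasure μ] [IsProbabilityMeasure ν] {π : Measure (X × X)}
    (hπ : IsCoupling π μ ν) {J : X → ℕ} (hJ : Measurable J) {c : X × X → ℝ≥0∞}
    {c' : ℕ × ℕ → ℝ≥0∞} {η : ℝ≥0∞}
    (hcc' : ∀ p, c p ≤ c' (Prod.map J J p) + η) (hc'c : ∀ p, c' (Prod.map J J p) ≤ c p + η)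
    {δ : ℝ≥0∞} (hδ : δ ≠ 0) :
    ∃ n v, IsSubcouplingDensity μ ν (gridDensity n v ∘ Prod.map J J) ∧
      ∫⁻ p, c p ∂(μ.prod ν).withDensity (gridDensity n v ∘ Prod.map J J) +
        (1 - ∫⁻ a, ∫⁻ b, (gridDensity n v ∘ Prod.map J J) (a, b) ∂ν ∂μ) ≤
      ∫⁻ p, c p ∂π + 2 * η + δ := by
  have hJJ : Measurable (Prod.map J J) := hJ.prodMap hJ
  have : IsProbabilityMeasure π := hπ.isProbabilityMeasure
  have : IsProbabilityMeasure (μ.map J) := Measure.isProbabilityMeasure_map hJ.aemeasurable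
  have : IsProbabilityMeasure (ν.map J) := Measure.isProbabilityMeasure_map hJ.aemeasurable
  have hπ' := hπ.map_prodMap hJ hJ
  obtain ⟨n, v, hle, hmass⟩ := exists_gridDensity_le hπ' hδ
  have hf' : Measurable (gridDensity n v) := measurable_of_countable _
  have hf := hf'.comp hJJ
  have hsub := isSubcouplingDensity_of_le hπ' hf' hle
  refine ⟨n, v, ⟨?_, ?_⟩, add_le_add ?_ ?_⟩
  · filter_upwards [ae_of_ae_map hJ.aemeasurable hsub.1] with a ha
    rwa [lintegral_map (by fun_prop) hJ] at ha
  · filter_upwards [ae_of_ae_map hJ.aemeasurable hsub.2] with b hb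
    rwa [lintegral_map (by fun_prop) hJ] at hb
  · have hc'm : Measurable c' := measurable_of_countable _
    calc ∫⁻ p, c p ∂(μ.prod ν).withDensity (gridDensity n v ∘ Prod.map J J)
        ≤ ∫⁻ p, c' (Prod.map J J p) + η
            ∂(μ.prod ν).withDensity (gridDensity n v ∘ Prod.map J J) := lintegral_mono hcc'
      _ = ∫⁻ p, c' p + η ∂((μ.map J).prod (ν.map J)).withDensity (gridDensity n v) := by
          rw [lintegral_withDensity_eq_lintegral_mul _ hf (by fun_prop),
            lintegral_withDensity_eq_lintegral_mul _ hf' (by fun_prop),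
            Measure.map_prod_map _ _ hJ hJ, lintegral_map (by fun_prop) hJJ]
          rfl
      _ ≤ ∫⁻ p, c' p + η ∂π.map (Prod.map J J) := lintegral_mono' hle le_rfl
      _ = ∫⁻ p, c' (Prod.map J J p) + η ∂π := lintegral_map (by fun_prop) hJJ
      _ ≤ ∫⁻ p, c p + η + η ∂π := lintegral_mono fun p => by gcongr; exact hc'c p
      _ = ∫⁻ p, c p ∂π + 2 * η := by
          rw [lintegral_add_right _ measurable_const, lintegral_add_right _ measurable_const]
          simp [two_mul, add_assoc]
  · rwa [Measure.map_prod_map _ _ hJ hJ, lintegral_map hf' hJJ,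
      lintegral_prod _ (by fun_prop)] at hmass

/-- Measurable selection from countably many kernels. -/
lemma exists_kernel_forall_exists_eq {A B ι : Type*} [MeasurableSpace A] [MeasurableSpace B]
    [Countable ι] (κ : ι → Kernel A B) {S : ι → Set A} (hS : ∀ i, MeasurableSet (S i))
    (hcover : ∀ a, ∃ i, a ∈ S i) :
    ∃ K : Kernel A B, ∀ a, ∃ i, a ∈ S i ∧ K a = κ i a := by
  classical
  rcases isEmpty_or_nonempty A with hA | ⟨⟨a₀⟩⟩
  · exact ⟨0, fun a => hA.elim a⟩
  have : Nonempty ι := ⟨(hcover a₀).choose⟩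
  obtain ⟨e, he⟩ := exists_surjective_nat ι
  have hcover' : ∀ a, ∃ n, a ∈ S (e n) := fun a => by
    obtain ⟨i, hi⟩ := hcover a
    obtain ⟨n, rfl⟩ := he i
    exact ⟨n, hi⟩
  exact ⟨⟨fun a => κ (e (Nat.find (hcover' a))) a,
    Measurable.find (f := fun n a => κ (e n) a) (p := fun n a => a ∈ S (e n))
      (fun n => (κ (e n)).measurable) (fun n => hS (e n)) hcover'⟩,
    fun a => ⟨_, Nat.find_spec (hcover' a), rfl⟩⟩

section CouplingKernel

variable {X : Type*} [MeasurableSpace X] (Q : Kernel X X) [IsMarkovKernel Q]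
  {f : X × X → ℝ≥0∞}

lemma measurable_lintegral_fst (hf : Measurable f) :
    Measurable fun q : X × X => ∫⁻ b, f (q.2, b) ∂(Q q.1) :=
  Measurable.lintegral_kernel_prod_right' (κ := Q.comap (fun q : X × X => q.1) measurable_fst)
    (f := fun r : (X × X) × X => f (r.1.2, r.2)) (by fun_prop)

lemma measurable_lintegral_snd (hf : Measurable f) :
    Measurable fun q : X × X => ∫⁻ a, f (a, q.2) ∂(Q q.1) :=
  measurable_lintegral_fst Q (hf.comp measurable_swap)

lemma measurable_uncurry_completedDensity (hf : Measurable f) :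
    Measurable (Function.uncurry fun p : X × X => completedDensity (Q p.1) (Q p.2) f) := by
  have h1 := measurable_lintegral_fst Q hf
  have h2 := measurable_lintegral_snd Q hf
  have h3 : Measurable fun p : X × X => ∫⁻ a, ∫⁻ b, f (a, b) ∂(Q p.2) ∂(Q p.1) :=
    Measurable.lintegral_kernel_prod_right'
      (κ := Q.comap (fun p : X × X => p.1) measurable_fst)
      (f := fun r : (X × X) × X => ∫⁻ b, f (r.2, b) ∂(Q r.1.2))
      (h1.comp (by fun_prop : Measurable fun r : (X × X) × X => (r.1.2, r.2)))
  refine (hf.comp measurable_snd).add (Measurable.mul ?_ (Measurable.mul ?_ ?_))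
  · exact ((measurable_const.sub h3).inv).comp measurable_fst
  · exact (measurable_const.sub h1).comp
      (by fun_prop : Measurable fun r : (X × X) × (X × X) => (r.1.2, r.2.1))
  · exact (measurable_const.sub h2).comp
      (by fun_prop : Measurable fun r : (X × X) × (X × X) => (r.1.1, r.2.2))

lemma measurableSet_isSubcouplingDensity (hf : Measurable f) :
    MeasurableSet {p : X × X | IsSubcouplingDensity (Q p.1) (Q p.2) f} := by
  have aux : ∀ {g : X × X → ℝ≥0∞}, Measurable g →
      MeasurableSet {p : X × X | ∀ᵐ a ∂(Q p.1), ∫⁻ b, g (a, b) ∂(Q p.2) ≤ 1} := by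
    intro g hg
    have h1 : MeasurableSet {r : (X × X) × X | ∫⁻ b, g (r.2, b) ∂(Q r.1.2) ≤ 1}ᶜ :=
      (measurableSet_le ((measurable_lintegral_fst Q hg).comp
        (by fun_prop : Measurable fun r : (X × X) × X => (r.1.2, r.2))) measurable_const).compl
    have h2 := Kernel.measurable_kernel_prodMk_left
      (κ := Q.comap (fun p : X × X => p.1) measurable_fst) h1
    exact h2 (measurableSet_singleton 0)
  exact (aux hf).inter ((aux (hf.comp measurable_swap)).preimage measurable_swap)

/-- The kernel of completed couplings associated with the density `f`. -/
def completedKernel (f : X × X → ℝ≥0∞) : Kernel (X × X) (X × X) :=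
  (Q.comap Prod.fst measurable_fst ×ₖ Q.comap Prod.snd measurable_snd).withDensity
    fun p => completedDensity (Q p.1) (Q p.2) f

lemma completedKernel_apply (hf : Measurable f) (p : X × X) :
    completedKernel Q f p =
      ((Q p.1).prod (Q p.2)).withDensity (completedDensity (Q p.1) (Q p.2) f) := by
  rw [completedKernel, Kernel.withDensity_apply _ (measurable_uncurry_completedDensity Q hf),
    Kernel.prod_apply]
  rfl

lemma isCoupling_map_diag {μ : Measure X} :
    IsCoupling (μ.map fun x => (x, x)) μ μ := by
  constructor
  · rw [Measure.map_map measurable_fst (by fun_prop)]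
    exact Measure.map_id
  · rw [Measure.map_map measurable_snd (by fun_prop)]
    exact Measure.map_id

/-- If strictly contracting couplings exist pointwise off the diagonal, then there is a Markov
kernel of contracting couplings. -/
lemma exists_contracting_kernel [MeasurableEq X] {c : X × X → ℝ≥0∞} (hc : Measurable c)
    (hc1 : ∀ p, c p ≤ 1) (hc0 : ∀ x, c (x, x) = 0) {J : ℕ → X → ℕ} (hJ : ∀ k, Measurable (J k))
    (hJc : ∀ δ : ℝ≥0∞, δ ≠ 0 → ∃ k, ∃ c' : ℕ × ℕ → ℝ≥0∞,
      (∀ p, c p ≤ c' (Prod.map (J k) (J k) p) + δ) ∧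
        ∀ p, c' (Prod.map (J k) (J k) p) ≤ c p + δ)
    {a : ℝ≥0∞}
    (hcontract : ∀ p : X × X, p.1 ≠ p.2 → c p < 1 →
      ∃ π, IsCoupling π (Q p.1) (Q p.2) ∧ ∫⁻ q, c q ∂π < a * c p) :
    ∃ K : Kernel (X × X) (X × X), (∀ p, IsCoupling (K p) (Q p.1) (Q p.2)) ∧
      ∀ p, c p < 1 → ∫⁻ q, c q ∂(K p) ≤ a * c p := by
  let F : ℕ × ℕ × (ℕ × ℕ →₀ ℕ) → X × X → ℝ≥0∞ := fun i =>
    gridDensity i.2.1 i.2.2 ∘ Prod.map (J i.1) (J i.1)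
  have hF : ∀ i, Measurable (F i) := fun i =>
    (measurable_of_countable _).comp ((hJ _).prodMap (hJ _))
  let κ : Option (ℕ × ℕ × (ℕ × ℕ →₀ ℕ)) → Kernel (X × X) (X × X) := fun o =>
    o.elim ((Q.comap Prod.fst measurable_fst).map fun x => (x, x))
      fun i => completedKernel Q (F i)
  let S : Option (ℕ × ℕ × (ℕ × ℕ →₀ ℕ)) → Set (X × X) := fun o =>
    o.elim {p | p.1 = p.2} fun i => {p | IsSubcouplingDensity (Q p.1) (Q p.2) (F i)} ∩
      {p | c p < 1 → ∫⁻ q, c q ∂(completedKernel Q (F i) p) ≤ a * c p}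
  have hS : ∀ o, MeasurableSet (S o) := by
    rintro (_ | i)
    · exact measurableSet_eq_fun measurable_fst measurable_snd
    · refine (measurableSet_isSubcouplingDensity Q (hF i)).inter ?_
      refine MeasurableSet.imp (measurableSet_lt hc measurable_const) (measurableSet_le ?_ ?_)
      · exact hc.lintegral_kernel
      · exact hc.const_mul a
  have hcover : ∀ p, ∃ o, p ∈ S o := by
    intro p
    by_cases hp : p.1 = p.2
    · exact ⟨none, hp⟩
    by_cases hcp : c p < 1
    · obtain ⟨π, hπ, hlt⟩ := hcontract p hp hcp
      obtain ⟨r, hr, hlt'⟩ := ENNReal.lt_iff_exists_add_pos_lt.1 hlt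
      have hδ : (r / 3 : ℝ≥0∞) ≠ 0 := by simpa using hr.ne'
      obtain ⟨k, c', h1, h2⟩ := hJc _ hδ
      obtain ⟨n, v, hsub, hcost⟩ := exists_gridDensity_comp hπ (hJ k) h1 h2 hδ
      refine ⟨some (k, n, v), hsub, fun _ => ?_⟩
      rw [completedKernel_apply Q (hF _)]
      refine (lintegral_completedDensity_le (hF (k, n, v)) hsub hc hc1).trans
        (hcost.trans (le_trans (le_of_eq ?_) hlt'.le))
      rw [add_assoc, ← add_one_mul, show (2 + 1 : ℝ≥0∞) = 3 by norm_num,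
        ENNReal.mul_div_cancel (by norm_num) (by norm_num)]
    · refine ⟨some (0, 0, 0), ?_, fun h => absurd h hcp⟩
      have h0 : F (0, 0, 0) = 0 := by ext; simp [F, gridDensity]
      simp [IsSubcouplingDensity, h0]
  obtain ⟨K, hK⟩ := exists_kernel_forall_exists_eq κ hS hcover
  refine ⟨K, fun p => ?_, fun p hp => ?_⟩
  · obtain ⟨_ | i, hi, hKp⟩ := hK p
    · have hp : p.1 = p.2 := hi
      rw [hKp, ← hp]
      change IsCoupling (Kernel.map _ _ p) _ _
      rw [Kernel.map_apply _ (by fun_prop)]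
      exact isCoupling_map_diag
    · rw [hKp]
      change IsCoupling (completedKernel Q (F i) p) _ _
      rw [completedKernel_apply Q (hF i)]
      exact isCoupling_completedDensity (hF i) hi.1
  · obtain ⟨_ | i, hi, hKp⟩ := hK p
    · rw [hKp]
      change ∫⁻ q, c q ∂(Kernel.map _ _ p) ≤ _
      rw [Kernel.map_apply _ (by fun_prop), lintegral_map hc (by fun_prop)]
      simp [hc0]
    · rw [hKp]
      exact hi.2 hp

end CouplingKernel

section ContinuousMetric

variable {X : Type*} {d : X → X → ℝ}

/-- A separable space on which `d` is continuous admits measurable partitions into countably many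
cells of arbitrarily small `d`-radius. -/
lemma exists_measurable_index [TopologicalSpace X] [SecondCountableTopology X] [Nonempty X]
    [MeasurableSpace X] [OpensMeasurableSpace X]
    (hd_cont : Continuous fun p : X × X => d p.1 p.2) (hd_eq_zero : ∀ x y, d x y = 0 ↔ x = y) :
    ∃ z : ℕ → X, ∀ r : ℝ, 0 < r → ∃ J : X → ℕ, Measurable J ∧ ∀ x, d x (z (J x)) < r := by
  classical
  refine ⟨TopologicalSpace.denseSeq X, fun r hr => ?_⟩
  have hex : ∀ x, ∃ n, d x (TopologicalSpace.denseSeq X n) < r := by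
    intro x
    have hopen : IsOpen {y | d x y < r} :=
      isOpen_lt (hd_cont.comp (by fun_prop : Continuous fun y => (x, y))) continuous_const
    obtain ⟨n, hy⟩ := (TopologicalSpace.denseRange_denseSeq X).exists_mem_open hopen
      ⟨x, by simpa [(hd_eq_zero x x).2 rfl] using hr⟩
    exact ⟨n, hy⟩
  refine ⟨fun x => Nat.find (hex x), measurable_find hex fun n => ?_, fun x => Nat.find_spec (hex x)⟩
  exact (isOpen_lt (hd_cont.comp (by fun_prop :
    Continuous fun x => (x, TopologicalSpace.denseSeq X n))) continuous_const).measurableSet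

/-- A contracting metric admits a Markov kernel of contracting couplings. -/
lemma exists_kernel_of_liftDist_le [MeasurableSpace X] [MeasurableEq X] (Q : Kernel X X)
    [IsMarkovKernel Q] (hd_meas : Measurable fun p : X × X => d p.1 p.2)
    (hd_symm : ∀ x y, d x y = d y x) (hd_triangle : ∀ x y z, d x z ≤ d x y + d y z)
    (hd_eq_zero : ∀ x y, d x y = 0 ↔ x = y) (hd_nonneg : ∀ x y, 0 ≤ d x y)
    (hd_le_one : ∀ x y, d x y ≤ 1)
    (hJ : ∃ z : ℕ → X, ∀ r : ℝ, 0 < r → ∃ J : X → ℕ, Measurable J ∧ ∀ x, d x (z (J x)) < r)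
    {α : ℝ} (hα : α < 1)
    (hcontract : ∀ x y, d x y < 1 →
      liftDist d (Q x) (Q y) ≤ ENNReal.ofReal (α * d x y)) :
    ∃ K : Kernel (X × X) (X × X), (∀ p, IsCoupling (K p) (Q p.1) (Q p.2)) ∧
      ∀ p, ENNReal.ofReal (d p.1 p.2) < 1 → ∫⁻ q, ENNReal.ofReal (d q.1 q.2) ∂(K p) ≤
        ENNReal.ofReal ((max α 0 + 1) / 2) * ENNReal.ofReal (d p.1 p.2) := by
  obtain ⟨z, hz⟩ := hJ
  choose J hJm hJ using fun k : ℕ => hz (1 / (k + 1)) Nat.one_div_pos_of_nat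
  refine exists_contracting_kernel Q (by fun_prop)
    (fun p => ENNReal.ofReal_le_one.2 (hd_le_one _ _))
    (fun x => by simp [(hd_eq_zero x x).2 rfl]) hJm (fun δ hδ => ?_) fun p hp hlt => ?_
  · have hlim : Tendsto (fun k : ℕ => ENNReal.ofReal (2 * (1 / ((k : ℝ) + 1)))) atTop (𝓝 0) := by
      simpa using ENNReal.tendsto_ofReal
        ((tendsto_one_div_add_atTop_nhds_zero_nat (𝕜 := ℝ)).const_mul 2)
    obtain ⟨k, hk⟩ := (hlim.eventually (gt_mem_nhds (pos_iff_ne_zero.2 hδ))).exists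
    have aux : ∀ s t : ℝ, 0 ≤ t → s ≤ t + 2 * (1 / ((k : ℝ) + 1)) →
        ENNReal.ofReal s ≤ ENNReal.ofReal t + δ := fun s t ht hst =>
      calc ENNReal.ofReal s ≤ ENNReal.ofReal (t + 2 * (1 / ((k : ℝ) + 1))) :=
            ENNReal.ofReal_le_ofReal hst
        _ ≤ ENNReal.ofReal t + ENNReal.ofReal (2 * (1 / ((k : ℝ) + 1))) := ENNReal.ofReal_add_le
        _ ≤ ENNReal.ofReal t + δ := by gcongr
    refine ⟨k, fun q => ENNReal.ofReal (d (z q.1) (z q.2)), fun p => ?_, fun p => ?_⟩ <;>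
      refine aux _ _ (hd_nonneg _ _) ?_ <;>
      simp only [Prod.map_fst, Prod.map_snd] <;>
      have h1 := hJ k p.1 <;>
      have h2 := hJ k p.2
    · have h3 := hd_triangle p.1 (z (J k p.1)) p.2
      have h4 := hd_triangle (z (J k p.1)) (z (J k p.2)) p.2
      rw [hd_symm (z (J k p.2)) p.2] at h4
      linarith
    · have h3 := hd_triangle (z (J k p.1)) p.1 (z (J k p.2))
      have h4 := hd_triangle p.1 p.2 (z (J k p.2))
      rw [hd_symm (z (J k p.1)) p.1] at h3
      linarith
  · have hd_pos : 0 < d p.1 p.2 :=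
      (hd_nonneg _ _).lt_of_ne' fun h => hp ((hd_eq_zero _ _).1 h)
    have hβ : α < (max α 0 + 1) / 2 := by
      rcases max_cases α 0 with h | h <;> linarith
    have hβ0 : 0 < (max α 0 + 1) / 2 := by positivity
    have h := (hcontract _ _ (by simpa using hlt)).trans_lt
      ((ENNReal.ofReal_lt_ofReal_iff (mul_pos hβ0 hd_pos)).2 (mul_lt_mul_of_pos_right hβ hd_pos))
    rw [ENNReal.ofReal_mul hβ0.le] at h
    obtain ⟨_, ⟨π, hπ, rfl⟩, hlt⟩ := sInf_lt_iff.1 h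
    exact ⟨π, hπ, hlt⟩

end ContinuousMetric

/-- **Proposition 4.13.** If `Q` is a Feller Markov kernel on a Polish space `X` and `d` is
a continuous `[0,1]`-valued metric generating the topology of `X` which is contracting for
`Q`, then there is a measurable family of couplings `Γ_{y,y'}` of the trajectory laws such
that the mass given to the diagonal at infinity is uniformly close to `1` in a
neighbourhood of every point. -/
theorem stmt_9 {X : Type*} [TopologicalSpace X] [PolishSpace X]
    [MeasurableSpace X] [BorelSpace X]
    (Q : Kernel X X) [IsMarkovKernel Q]
    (hFeller : ∀ f : X →ᵇ ℝ, Continuous (fun x => ∫ y, f y ∂(Q x)))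
    (d : X → X → ℝ)
    (hd_cont : Continuous (fun p : X × X => d p.1 p.2))
    (hd_symm : ∀ x y, d x y = d y x)
    (hd_triangle : ∀ x y z, d x z ≤ d x y + d y z)
    (hd_eq_zero : ∀ x y, d x y = 0 ↔ x = y)
    (hd_nonneg : ∀ x y, 0 ≤ d x y) (hd_le_one : ∀ x y, d x y ≤ 1)
    -- `d` generates the topology of `X`
    (hd_top : ∀ (x : X) (s : Set X), s ∈ nhds x ↔ ∃ ε : ℝ, 0 < ε ∧ {y | d x y < ε} ⊆ s)
    -- `d` is contracting for `Q`
    (hcontract : ∃ α : ℝ, α < 1 ∧ ∀ x y, d x y < 1 →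
      liftDist d (Q x) (Q y) ≤ ENNReal.ofReal (α * d x y)) :
    ∃ Γ : X → X → Measure ((ℕ → X) × (ℕ → X)),
      (∀ φ : ((ℕ → X) × (ℕ → X)) →ᵇ ℝ,
        Measurable (fun p : X × X => ∫ ω, φ ω ∂(Γ p.1 p.2))) ∧
      (∀ y y' : X,
        IsTrajLaw Q (Measure.dirac y) ((Γ y y').map Prod.fst) ∧
        IsTrajLaw Q (Measure.dirac y') ((Γ y y').map Prod.snd)) ∧
      ∀ ε : ℝ, 0 < ε → ∀ x : X, ∃ U ∈ nhds x,
        ∀ y ∈ U, ∀ y' ∈ U, ENNReal.ofReal (1 - ε) ≤ Γ y y' (diagInfD d) := by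
  rcases isEmpty_or_nonempty X with hX | hX
  · exact ⟨fun _ _ => 0, fun φ => by simp, fun y => hX.elim y, fun ε _ x => hX.elim x⟩
  obtain ⟨α, hα, hcontract⟩ := hcontract
  obtain ⟨K, hK, hKc⟩ := exists_kernel_of_liftDist_le Q hd_cont.measurable hd_symm hd_triangle
    hd_eq_zero hd_nonneg hd_le_one (exists_measurable_index hd_cont hd_eq_zero) hα hcontract
  have : IsMarkovKernel K := ⟨fun p => (hK p).isProbabilityMeasure⟩
  obtain ⟨T, hT, hTK⟩ := exists_kernel_isTrajLaw K
  let e : (ℕ → X × X) → (ℕ → X) × (ℕ → X) := fun ω => (fun n => (ω n).1, fun n => (ω n).2)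
  have he : Measurable e := by fun_prop
  refine ⟨fun y y' => (T (y, y')).map e, fun φ => ?_, fun y y' => ⟨?_, ?_⟩, fun ε hε x => ?_⟩
  · have h := (φ.continuous.measurable.stronglyMeasurable.integral_kernel (κ := T.map e)).measurable
    simpa only [Kernel.map_apply T he] using h
  · have h := (hTK (y, y')).map measurable_fst fun p => (hK p).1
    rw [Measure.map_dirac' measurable_fst] at h
    dsimp only
    rwa [Measure.map_map measurable_fst he]
  · have h := (hTK (y, y')).map measurable_snd fun p => (hK p).2
    rw [Measure.map_dirac' measurable_snd] at h
    dsimp only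
    rwa [Measure.map_map measurable_snd he]
  · set β := (max α 0 + 1) / 2 with hβ
    have hβ0 : 0 ≤ β := by positivity
    have hβ1 : β < 1 := by
      have : max α 0 < 1 := max_lt hα one_pos
      linarith
    refine ⟨{y | d x y < ε * (1 - β) / 2},
      (hd_top x _).2 ⟨_, by have := mul_pos hε (sub_pos.2 hβ1); positivity, subset_rfl⟩,
      fun y hy y' hy' => ?_⟩
    have hyy' : d y y' ≤ ε * (1 - β) := by
      have h1 := hd_triangle y x y'
      rw [hd_symm y x] at h1
      have h2 : d x y < ε * (1 - β) / 2 := hy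
      have h3 : d x y' < ε * (1 - β) / 2 := hy'
      linarith
    have hmain := (hTK (y, y')).one_sub_le_measure_tendsto
      (c := fun p => ENNReal.ofReal (d p.1 p.2)) (by have := hd_cont.measurable; fun_prop) hKc
    refine le_trans ?_ (hmain.trans ((measure_mono fun ω hω => ?_).trans
      (Measure.le_map_apply he.aemeasurable _)))
    · rw [ENNReal.ofReal_sub _ hε.le, ENNReal.ofReal_one]
      gcongr
      rw [← ENNReal.ofReal_one, ← ENNReal.ofReal_sub _ hβ0,
        ← ENNReal.ofReal_inv_of_pos (sub_pos.2 hβ1),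
        ← ENNReal.ofReal_mul (inv_nonneg.2 (sub_pos.2 hβ1).le)]
      refine ENNReal.ofReal_le_ofReal ?_
      rwa [inv_mul_le_iff₀ (sub_pos.2 hβ1), mul_comm]
    · have h := (ENNReal.tendsto_toReal ENNReal.zero_ne_top).comp hω
      have h' : Tendsto (fun n => d (ω n).1 (ω n).2) atTop (𝓝 0) := by
        simpa [Function.comp_def, ENNReal.toReal_ofReal (hd_nonneg _ _)] using h
      exact h'
end
end

section
/- Let H be a separable Hilbert space, {P_t}_{t≥0} a Markov semigroup on H, and W: H → [1,∞) a continuous function such that the following gradient bound holds for some constants γ̃ > 0 and C > 0: for every bounded Fréchet-C¹ function φ: H → ℝ with bounded derivative and every t ≥ 0, the function P_tφ is Fréchet differentiable and ‖D(P_tφ)(X)‖ ≤ W(X)(e^{−γ̃ t} √((P_t ‖Dφ‖²)(X)) + C ‖φ‖_∞) for all X ∈ H. Assume furthermore that there exist p > 1, a time t★ > 0 and a constant C̃ > 0 such that (P_t W^{2p})(X) ≤ C̃ W^{2p−2}(X) for every X ∈ H and every t ≥ t★. Define ρ_p(X,Y) = inf over Lipschitz continuous paths γ: [0,1] → H with γ(0)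 = X, γ(1) = Y of ∫₀¹ W^p(γ(t)) ‖γ̇(t)‖ dt. Then there exist δ > 0 and T > 0 such that the metric d(X,Y) = 1 ∧ δ⁻¹ ρ_p(X,Y) is contracting for P_T. -/
open MeasureTheory ProbabilityTheory Filter Topology
open scoped ENNReal NNReal

noncomputable section

/-- The weighted path metric `ρ_p(X,Y)`: the infimum over Lipschitz paths `γ` from `X` to
`Y` of `∫₀¹ W^p(γ(t)) ‖γ̇(t)‖ dt`. -/
def rhoP {H : Type*} [NormedAddCommGroup H] [NormedSpace ℝ H]
    (W : H → ℝ) (p : ℝ) (x y : H) : ℝ :=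
  sInf {r : ℝ | ∃ γ : ℝ → H, (∃ K : ℝ≥0, LipschitzWith K γ) ∧ γ 0 = x ∧ γ 1 = y ∧
    r = ∫ t in (0:ℝ)..1, W (γ t) ^ p * ‖deriv γ t‖}

theorem HilbertBasis.countable_index {ι H : Type*} [NormedAddCommGroup H] [InnerProductSpace ℝ H]
    [SecondCountableTopology H] (b : HilbertBasis ι ℝ H) : Countable ι := by
  have hd : Pairwise (Function.onFun Disjoint fun i => Metric.ball (b i) (1 / 2)) := by
    intro i j hij
    refine Metric.ball_disjoint_ball ?_
    have h0 : inner ℝ (b i) (b j) = (0 : ℝ) := b.orthonormal.2 hij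
    have h1 : ‖b i - b j‖ ^ 2 = 2 := by
      rw [norm_sub_sq_real, h0, b.orthonormal.1, b.orthonormal.1]; norm_num
    rw [dist_eq_norm]
    nlinarith [norm_nonneg (b i - b j)]
  exact hd.countable_of_isOpen_disjoint (fun i => Metric.isOpen_ball)
    fun i => Metric.nonempty_ball.2 (by norm_num)

/-- Hilbert spaces have the Radon–Nikodym property: Lipschitz curves are differentiable a.e. -/
theorem LipschitzWith.ae_differentiableAt_hilbert {H : Type*} [NormedAddCommGroup H]
    [InnerProductSpace ℝ H] [CompleteSpace H] [SecondCountableTopology H]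
    {K : ℝ≥0} {γ : ℝ → H} (hγ : LipschitzWith K γ) : ∀ᵐ t, DifferentiableAt ℝ γ t := by
  obtain ⟨w, b, -⟩ := exists_hilbertBasis ℝ H
  have : Countable w := b.countable_index
  have hcoord (i : w) : LipschitzWith K fun t => inner ℝ (b i) (γ t) := by
    refine LipschitzWith.of_dist_le_mul fun s t => ?_
    rw [Real.dist_eq, ← inner_sub_right]
    refine (abs_real_inner_le_norm _ _).trans ?_
    rw [b.orthonormal.1, one_mul, ← dist_eq_norm]
    exact hγ.dist_le_mul s t
  have hdiff : ∀ᵐ t, ∀ i : w, DifferentiableAt ℝ (fun t => inner ℝ (b i) (γ t)) t :=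
    ae_all_iff.2 fun i => (hcoord i).ae_differentiableAt_real
  set c : w → ℝ → ℝ := fun i t => deriv (fun t => inner ℝ (b i) (γ t)) t with hc
  have hbound : ∀ t, (∀ i : w, DifferentiableAt ℝ (fun t => inner ℝ (b i) (γ t)) t) →
      ∀ s : Finset w, ‖∑ i ∈ s, c i t • b i‖ ≤ K := by
    intro t ht s
    have hder : HasDerivAt (fun t => ∑ i ∈ s, (inner ℝ (b i) (γ t) : ℝ) • b i)
        (∑ i ∈ s, c i t • b i) t :=
      HasDerivAt.fun_sum fun i _ => (ht i).hasDerivAt.smul_const (b i)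
    refine hder.le_of_lipschitz (LipschitzWith.of_dist_le_mul fun u v => ?_)
    rw [dist_eq_norm, ← Finset.sum_sub_distrib]
    simp_rw [← sub_smul, ← inner_sub_right]
    refine le_trans ?_ (hγ.dist_le_mul u v)
    rw [dist_eq_norm]
    refine (sq_le_sq₀ (norm_nonneg _) (norm_nonneg _)).1 ?_
    have h := b.orthonormal.sum_inner_products_le (γ u - γ v) (s := s)
    rw [← real_inner_self_eq_norm_sq, b.orthonormal.inner_sum]
    simpa [sq] using h
  have hsum : ∀ t, (∀ i : w, DifferentiableAt ℝ (fun t => inner ℝ (b i) (γ t)) t) →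
      Summable fun i => c i t • b i := by
    intro t ht
    have h := b.orthonormal.orthogonalFamily.summable_iff_norm_sq_summable fun i => c i t
    simp only [LinearIsometry.toSpanSingleton_apply] at h
    refine h.2 (summable_of_sum_le (c := (K : ℝ) ^ 2) (fun i => by positivity) fun s => ?_)
    have h2 := pow_le_pow_left₀ (norm_nonneg _) (hbound t ht s) 2
    rw [← real_inner_self_eq_norm_sq, b.orthonormal.inner_sum] at h2
    simpa [sq] using h2
  set g : ℝ → H := fun t => ∑' i, c i t • b i with hg
  have hgK : ∀ᵐ t, ‖g t‖ ≤ K := by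
    filter_upwards [hdiff] with t ht
    exact le_of_tendsto (hsum t ht).hasSum.norm (Eventually.of_forall (hbound t ht))
  have hgm : AEStronglyMeasurable g volume := by
    refine aestronglyMeasurable_of_tendsto_ae (u := atTop)
      (f := fun (s : Finset w) t => ∑ i ∈ s, c i t • b i) (fun s => ?_) ?_
    · exact (Finset.stronglyMeasurable_fun_sum s fun i _ =>
        ((measurable_deriv _).stronglyMeasurable.smul_const (b i))).aestronglyMeasurable
    · filter_upwards [hdiff] with t ht
      exact (hsum t ht).hasSum
  have hgl : LocallyIntegrable g volume := by
    intro x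
    refine ⟨Metric.closedBall x 1, Metric.closedBall_mem_nhds x one_pos, ?_⟩
    exact Measure.integrableOn_of_bounded (M := K) measure_closedBall_lt_top.ne hgm
      (ae_restrict_of_ae hgK)
  have hgi (s t : ℝ) : IntervalIntegrable g volume s t :=
    (hgl.integrableOn_isCompact isCompact_uIcc).intervalIntegrable
  have hrep : ∀ t, γ t = γ 0 + ∫ s in (0:ℝ)..t, g s := by
    intro t
    refine b.repr.injective (lp.ext (funext fun i => ?_))
    rw [b.repr_apply_apply, b.repr_apply_apply, inner_add_right]
    have h1 := (innerSL ℝ (b i)).intervalIntegral_comp_comm (hgi 0 t)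
    simp only [innerSL_apply_apply] at h1
    rw [← h1, ← sub_eq_iff_eq_add',
      ← ((hcoord i).lipschitzOnWith.absolutelyContinuousOnInterval).integral_deriv_eq_sub]
    refine intervalIntegral.integral_congr_ae ?_
    filter_upwards [hdiff] with s hs _
    have h2 := ((innerSL ℝ (b i)).hasSum (hsum s hs).hasSum).tsum_eq
    simp only [innerSL_apply_apply] at h2
    rw [← h2, tsum_eq_single i fun j hj => ?_]
    · simp [inner_smul_right, b.orthonormal.1, hc]
    · rw [inner_smul_right, b.orthonormal.2 hj.symm, mul_zero]
  filter_upwards [_root_.LocallyIntegrable.ae_hasDerivAt_integral hgl] with t ht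
  have h1 := ((ht 0).const_add (γ 0)).differentiableAt
  exact h1.congr_of_eventuallyEq (Eventually.of_forall hrep)

/-- Finite transport duality. -/
theorem exists_transport_plan_of_dual_bound {ι : Type*} [Fintype ι] [Nonempty ι]
    (a b : ι → ℝ) (ha : ∀ i, 0 ≤ a i) (hb : ∀ i, 0 ≤ b i) (ha1 : ∑ i, a i = 1)
    (hb1 : ∑ i, b i = 1) (c : ι → ι → ℝ) (r : ℝ)
    (hdual : ∀ f g : ι → ℝ, (∀ i j, -c i j ≤ f i + g j) →
      -r ≤ ∑ i, f i * a i + ∑ j, g j * b j) :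
    ∃ m : ι → ι → ℝ, (∀ i j, 0 ≤ m i j) ∧ (∀ i, ∑ j, m i j = a i) ∧
      (∀ j, ∑ i, m i j = b j) ∧ ∑ i, ∑ j, m i j * c i j ≤ r := by
  classical
  let L : (ι × ι → ℝ) →ₗ[ℝ] (ι → ℝ) × (ι → ℝ) × ℝ :=
    { toFun := fun m => (fun i => ∑ j, m (i, j), fun j => ∑ i, m (i, j),
        ∑ i, ∑ j, m (i, j) * c i j)
      map_add' := fun m m' => by
        ext <;> simp [Finset.sum_add_distrib, add_mul]
      map_smul' := fun t m => by
        ext <;> simp [Finset.mul_sum, mul_assoc] }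
  by_cases hdisj : Disjoint (L '' stdSimplex ℝ (ι × ι)) ({a} ×ˢ {b} ×ˢ Set.Iic r)
  · exfalso
    obtain ⟨F, u, v, hF1, huv, hF2⟩ := geometric_hahn_banach_compact_closed
      ((convex_stdSimplex ℝ (ι × ι)).linear_image L)
      ((isCompact_stdSimplex ℝ (ι × ι)).image L.continuous_of_finiteDimensional)
      ((convex_singleton a).prod ((convex_singleton b).prod (convex_Iic r)))
      (isClosed_singleton.prod (isClosed_singleton.prod isClosed_Iic)) hdisj
    set F1 : ι → ℝ := fun i => F (Pi.single i 1, 0, 0) with hF1d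
    set F2 : ι → ℝ := fun j => F (0, Pi.single j 1, 0) with hF2d
    set l : ℝ := F (0, 0, 1) with hl
    have hF (x y : ι → ℝ) (s : ℝ) :
        F (x, y, s) = ∑ i, F1 i * x i + ∑ j, F2 j * y j + l * s := by
      have e : ((x, y, s) : (ι → ℝ) × (ι → ℝ) × ℝ)
          = ∑ i, x i • (Pi.single i 1, 0, 0) + ∑ j, y j • (0, Pi.single j 1, 0)
            + s • (0, 0, 1) := by
        have h1 : ∀ z : ι → ℝ, z = ∑ i, z i • (Pi.single i 1 : ι → ℝ) := fun z => by
          ext k; simp [Pi.single_apply]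
        ext k <;> simp [Prod.fst_sum, Prod.snd_sum, Pi.single_apply]
      rw [e, map_add, map_add, map_sum, map_sum]
      simp only [map_smul, smul_eq_mul, hF1d, hF2d, hl]
      congr 1
      · congr 1 <;> exact Finset.sum_congr rfl fun _ _ => mul_comm _ _
      · exact mul_comm _ _
    have hpt (i j : ι) : F1 i + F2 j + l * c i j < u := by
      have h := hF1 _ ⟨_, single_mem_stdSimplex ℝ (i, j), rfl⟩
      have e : L (Pi.single (i, j) 1) = (Pi.single i 1, Pi.single j 1, c i j) := by
        ext k
        · simp [L, Pi.single_apply, Prod.ext_iff, ite_and]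
        · simp [L, Pi.single_apply, Prod.ext_iff, ite_and]
        · simp [L, Pi.single_apply, Prod.ext_iff, ite_and]
      rw [e, hF] at h
      simpa [Pi.single_apply] using h
    have hs (s : ℝ) (hsr : s ≤ r) : v < ∑ i, F1 i * a i + ∑ j, F2 j * b j + l * s := by
      rw [← hF]
      exact hF2 _ ⟨rfl, rfl, hsr⟩
    have hl0 : l ≤ 0 := by
      by_contra! hlpos
      set S := ∑ i, F1 i * a i + ∑ j, F2 j * b j
      have h := hs (min r ((v - S) / l)) (min_le_left _ _)
      have h2 : l * min r ((v - S) / l) ≤ l * ((v - S) / l) :=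
        mul_le_mul_of_nonneg_left (min_le_right _ _) hlpos.le
      rw [mul_div_cancel₀ _ hlpos.ne'] at h2
      linarith
    have hr := hs r le_rfl
    have hub : ∑ j, (u - F2 j) * b j = u - ∑ j, F2 j * b j := by
      simp [sub_mul, Finset.sum_sub_distrib, ← Finset.mul_sum, hb1]
    rcases hl0.lt_or_eq with hneg | hzero
    · have h := hdual (fun i => -F1 i / -l) (fun j => (u - F2 j) / -l) fun i j => by
        have := hpt i j
        rw [← add_div, le_div_iff₀ (by linarith)]
        linarith
      have e : ∑ i, -F1 i / -l * a i + ∑ j, (u - F2 j) / -l * b j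
          = (-∑ i, F1 i * a i + (u - ∑ j, F2 j * b j)) / -l := by
        rw [← hub, add_div, ← Finset.sum_neg_distrib, Finset.sum_div, Finset.sum_div]
        congr 1 <;> refine Finset.sum_congr rfl fun i _ => by ring
      rw [e, le_div_iff₀ (by linarith)] at h
      nlinarith
    · have h : 0 ≤ ∑ i, ∑ j, a i * b j * (-F1 i + (u - F2 j)) :=
        Finset.sum_nonneg fun i _ => Finset.sum_nonneg fun j _ =>
          mul_nonneg (mul_nonneg (ha i) (hb j)) (by
            have := hpt i j
            rw [hzero] at this
            linarith)
      have e : ∑ i, ∑ j, a i * b j * (-F1 i + (u - F2 j))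
          = -∑ i, F1 i * a i + (u - ∑ j, F2 j * b j) := by
        have e1 : ∀ i, ∑ j, a i * b j * (-F1 i + (u - F2 j))
            = -(F1 i * a i) + a i * (u - ∑ j, F2 j * b j) := by
          intro i
          rw [← hub, Finset.mul_sum]
          calc ∑ j, a i * b j * (-F1 i + (u - F2 j))
              = ∑ j, (-(F1 i * a i) * b j + a i * ((u - F2 j) * b j)) :=
                Finset.sum_congr rfl fun j _ => by ring
            _ = _ := by rw [Finset.sum_add_distrib, ← Finset.mul_sum, hb1, mul_one]
        simp_rw [e1]
        rw [Finset.sum_add_distrib, ← Finset.sum_mul, ha1, one_mul, Finset.sum_neg_distrib]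
      rw [e] at h
      rw [hzero] at hr
      linarith
  · obtain ⟨_, ⟨m, hm, rfl⟩, h1, h2, h3⟩ := Set.not_disjoint_iff.1 hdisj
    refine ⟨fun i j => m (i, j), fun i j => hm.1 _, fun i => congrFun h1 i,
      fun j => congrFun h2 j, h3⟩

/-- A coupling of two probability measures obtained from a transport plan between the masses they
give to the fibres of a simple function. -/
theorem exists_coupling_of_simpleFunc {X : Type*} [MeasurableSpace X]
    (μ ν : Measure X) [IsProbabilityMeasure μ] [IsProbabilityMeasure ν] (s : SimpleFunc X X)
    (m : s.range → s.range → ℝ) (hm : ∀ i j, 0 ≤ m i j)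
    (hμ : ∀ i, ∑ j, m i j = μ.real (s ⁻¹' {i.1})) (hν : ∀ j, ∑ i, m i j = ν.real (s ⁻¹' {j.1}))
    (c : X → X → ℝ≥0∞) :
    ∃ π : Measure (X × X), IsCoupling π μ ν ∧
      ∫⁻ p, c (s p.1) (s p.2) ∂π = ∑ i, ∑ j, ENNReal.ofReal (m i j) * c i j := by
  classical
  set A : s.range → Set X := fun i => s ⁻¹' {i.1} with hA
  have hAm (i) : MeasurableSet (A i) := s.measurableSet_fiber _
  set w : s.range → s.range → ℝ≥0∞ := fun i j =>
    ENNReal.ofReal (m i j) * (μ (A i))⁻¹ * (ν (A j))⁻¹ with hw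
  have hmμ (i j) (h : μ (A i) = 0) : m i j = 0 := by
    have h1 := hμ i
    rw [measureReal_def, h, ENNReal.toReal_zero,
      Finset.sum_eq_zero_iff_of_nonneg fun j _ => hm i j] at h1
    exact h1 j (Finset.mem_univ _)
  have hmν (i j) (h : ν (A j) = 0) : m i j = 0 := by
    have h1 := hν j
    rw [measureReal_def, h, ENNReal.toReal_zero,
      Finset.sum_eq_zero_iff_of_nonneg fun i _ => hm i j] at h1
    exact h1 i (Finset.mem_univ _)
  have hwμ (i j) : w i j * μ (A i) = ENNReal.ofReal (m i j) * (ν (A j))⁻¹ := by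
    by_cases h : μ (A i) = 0
    · simp [hw, hmμ i j h]
    · rw [hw, mul_right_comm, mul_assoc _ (μ (A i))⁻¹, ENNReal.inv_mul_cancel h (measure_ne_top _ _),
        mul_one]
  have hwν (i j) : w i j * ν (A j) = ENNReal.ofReal (m i j) * (μ (A i))⁻¹ := by
    by_cases h : ν (A j) = 0
    · simp [hw, hmν i j h]
    · rw [hw, mul_assoc _ (ν (A j))⁻¹, ENNReal.inv_mul_cancel h (measure_ne_top _ _), mul_one]
  have hsplit (ρ : Measure X) : ∑ i, ρ.restrict (A i) = ρ := by
    rw [← Measure.sum_fintype, ← Measure.restrict_iUnion _ hAm]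
    · have : ⋃ i, A i = Set.univ := by
        ext x
        simp only [hA, Set.mem_iUnion, Set.mem_preimage, Set.mem_singleton_iff, Set.mem_univ,
          iff_true]
        exact ⟨⟨s x, s.mem_range_self x⟩, rfl⟩
      rw [this, Measure.restrict_univ]
    · intro i j hij
      refine Set.disjoint_left.2 fun x hx hx' => hij (Subtype.ext ?_)
      rw [← show s x = i from hx, ← show s x = j from hx']
  refine ⟨∑ i, ∑ j, w i j • (μ.restrict (A i)).prod (ν.restrict (A j)), ⟨?_, ?_⟩, ?_⟩
  · conv_rhs => rw [← hsplit μ]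
    rw [Measure.map_finset_sum measurable_fst.aemeasurable]
    refine Finset.sum_congr rfl fun i _ => ?_
    rw [Measure.map_finset_sum measurable_fst.aemeasurable]
    simp_rw [Measure.map_smul, Measure.map_fst_prod, Measure.restrict_apply_univ, smul_smul, hwν]
    rw [← Finset.sum_smul, ← Finset.sum_mul, ← ENNReal.ofReal_sum_of_nonneg fun j _ => hm i j, hμ,
      ofReal_measureReal]
    by_cases h : μ (A i) = 0
    · simp [Measure.restrict_eq_zero.2 h]
    · rw [ENNReal.mul_inv_cancel h (measure_ne_top _ _), one_smul]
  · conv_rhs => rw [← hsplit ν]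
    rw [Finset.sum_comm, Measure.map_finset_sum measurable_snd.aemeasurable]
    refine Finset.sum_congr rfl fun j _ => ?_
    rw [Measure.map_finset_sum measurable_snd.aemeasurable]
    simp_rw [Measure.map_smul, Measure.map_snd_prod, Measure.restrict_apply_univ, smul_smul, hwμ]
    rw [← Finset.sum_smul, ← Finset.sum_mul, ← ENNReal.ofReal_sum_of_nonneg fun i _ => hm i j, hν,
      ofReal_measureReal]
    by_cases h : ν (A j) = 0
    · simp [Measure.restrict_eq_zero.2 h]
    · rw [ENNReal.mul_inv_cancel h (measure_ne_top _ _), one_smul]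
  · rw [lintegral_finsetSum_measure]
    refine Finset.sum_congr rfl fun i _ => ?_
    rw [lintegral_finsetSum_measure]
    refine Finset.sum_congr rfl fun j _ => ?_
    rw [lintegral_smul_measure, Measure.prod_restrict,
      setLIntegral_congr_fun (g := fun _ => c i j) ((hAm i).prod (hAm j))
        (fun p hp => by
          have h1 : s p.1 = i := hp.1
          have h2 : s p.2 = j := hp.2
          simp only [h1, h2]), setLIntegral_const, Measure.prod_prod, smul_eq_mul,
      mul_comm (c i j), ← mul_assoc, ← mul_assoc, hwμ]
    by_cases h : ν (A j) = 0
    · simp [hmν i j h]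
    · rw [mul_assoc _ (ν (A j))⁻¹, ENNReal.inv_mul_cancel h (measure_ne_top _ _), mul_one]

/-- Approximate Kantorovich duality for bounded uniformly continuous pseudometrics. -/
theorem exists_coupling_of_dual_bound {X : Type*} [PseudoMetricSpace X]
    [SecondCountableTopology X] [MeasurableSpace X] [BorelSpace X]
    (μ ν : Measure X) [IsProbabilityMeasure μ] [IsProbabilityMeasure ν]
    (c : X → X → ℝ) (hc0 : ∀ x y, 0 ≤ c x y) (hc1 : ∀ x y, c x y ≤ 1) (hself : ∀ x, c x x = 0)
    (hsymm : ∀ x y, c x y = c y x) (htri : ∀ x y z, c x z ≤ c x y + c y z)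
    (hunif : ∀ x, Tendsto (fun y => c x y) (𝓝 x) (𝓝 0)) (r : ℝ)
    (hdual : ∀ φ : X → ℝ, (∀ x, 0 ≤ φ x) → (∀ x, φ x ≤ 1) → (∀ x y, φ y - φ x ≤ c x y) →
      ∫ x, φ x ∂ν - ∫ x, φ x ∂μ ≤ r) (ε : ℝ) (hε : 0 < ε) :
    ∃ π : Measure (X × X), IsCoupling π μ ν ∧
      ∫⁻ p, ENNReal.ofReal (c p.1 p.2) ∂π ≤ ENNReal.ofReal (r + ε) := by
  classical
  have : Nonempty X := (inferInstance : NeZero μ).out |> fun h => by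
    by_contra hX
    rw [not_nonempty_iff] at hX
    exact h (Measure.eq_zero_of_isEmpty μ)
  have hcont : Continuous fun p : X × X => c p.1 p.2 := by
    refine continuous_iff_continuousAt.2 fun p => tendsto_iff_dist_tendsto_zero.2 ?_
    have h1 := ((hunif p.1).comp (continuous_fst.tendsto p)).add
      ((hunif p.2).comp (continuous_snd.tendsto p))
    rw [add_zero] at h1
    refine squeeze_zero (fun _ => dist_nonneg) (fun q => ?_) h1
    rw [Real.dist_eq, abs_le]
    have h2 := htri q.1 p.1 q.2
    have h3 := htri p.1 p.2 q.2
    have h4 := htri p.1 q.1 p.2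
    have h5 := htri q.1 q.2 p.2
    have h6 := hsymm q.1 p.1
    have h7 := hsymm q.2 p.2
    constructor <;> simp only [Function.comp] <;> linarith
  set e := TopologicalSpace.denseSeq X
  have hlim (ρ : Measure X) [IsProbabilityMeasure ρ] :
      Tendsto (fun N => ∫ x, c x (SimpleFunc.nearestPt e N x) ∂ρ) atTop (𝓝 0) := by
    rw [← integral_zero X ℝ (μ := ρ)]
    refine tendsto_integral_of_dominated_convergence (fun _ => 1) (fun N => ?_)
      (integrable_const 1) (fun N => ae_of_all _ fun x => ?_) (ae_of_all _ fun x => ?_)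
    · exact (hcont.measurable.comp
        (measurable_id.prodMk (SimpleFunc.measurable _))).aestronglyMeasurable
    · rw [Real.norm_eq_abs, abs_of_nonneg (hc0 _ _)]
      exact hc1 _ _
    · exact (hunif x).comp (SimpleFunc.tendsto_nearestPt (TopologicalSpace.denseRange_denseSeq X x))
  obtain ⟨N, hNμ, hNν⟩ := (((hlim μ).eventually (gt_mem_nhds (by positivity : 0 < ε / 4))).and
    ((hlim ν).eventually (gt_mem_nhds (by positivity : 0 < ε / 4)))).exists
  set s := SimpleFunc.nearestPt e N
  have hcs : Measurable fun x => c x (s x) :=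
    hcont.measurable.comp (measurable_id.prodMk s.measurable)
  have hint (ρ : Measure X) [IsProbabilityMeasure ρ] : Integrable (fun x => c x (s x)) ρ :=
    Integrable.of_bound hcs.aestronglyMeasurable 1 (ae_of_all _ fun x => by
      rw [Real.norm_eq_abs, abs_of_nonneg (hc0 _ _)]
      exact hc1 _ _)
  have hne : Nonempty s.range := ⟨⟨s (Classical.arbitrary X), s.mem_range_self _⟩⟩
  have hsum (ρ : Measure X) [IsProbabilityMeasure ρ] (φ : X → ℝ) :
      ∫ x, φ (s x) ∂ρ = ∑ i : s.range, φ i * ρ.real (s ⁻¹' {i.1}) := by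
    have h1 : ∀ x, φ (s x) = ∑ i : s.range, (s ⁻¹' {i.1}).indicator (fun _ => φ i) x := by
      intro x
      rw [Finset.sum_eq_single ⟨s x, s.mem_range_self x⟩]
      · simp
      · intro i _ hi
        refine Set.indicator_of_notMem (fun h => hi ?_) _
        exact Subtype.ext (Eq.symm h)
      · simp
    simp_rw [h1]
    rw [integral_finsetSum _ fun i _ => (integrable_const _).indicator (s.measurableSet_fiber _)]
    refine Finset.sum_congr rfl fun i _ => ?_
    rw [integral_indicator_const _ (s.measurableSet_fiber _), smul_eq_mul, mul_comm]
  have hone (ρ : Measure X) [IsProbabilityMeasure ρ] :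
      ∑ i : s.range, ρ.real (s ⁻¹' {i.1}) = 1 := by
    simpa using (hsum ρ fun _ => 1).symm
  obtain ⟨m, hm, hmμ, hmν, hcost⟩ := exists_transport_plan_of_dual_bound
    (fun i : s.range => μ.real (s ⁻¹' {i.1})) (fun i => ν.real (s ⁻¹' {i.1}))
    (fun _ => measureReal_nonneg) (fun _ => measureReal_nonneg) (hone μ) (hone ν)
    (fun i j => c i j) (r + ε / 2) (by
      intro f g hfg
      set φ : X → ℝ := fun x => Finset.univ.inf' Finset.univ_nonempty fun i : s.range => f i + c i x
      set l : ℝ := Finset.univ.inf' Finset.univ_nonempty f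
      have hφc (x y) : φ y - φ x ≤ c x y := by
        obtain ⟨i, -, hi⟩ := Finset.exists_mem_eq_inf' (Finset.univ_nonempty (α := s.range))
          fun i => f i + c i x
        have h1 : φ y ≤ f i + c i y := Finset.inf'_le _ (Finset.mem_univ i)
        have h2 : φ x = f i + c i x := hi
        linarith [htri i x y]
      have hφ0 (x) : l ≤ φ x := Finset.le_inf' _ _ fun i hi => by
        linarith [hc0 i x, Finset.inf'_le f hi]
      have hφ1 (x) : φ x ≤ l + 1 := by
        obtain ⟨i, -, hi⟩ := Finset.exists_mem_eq_inf' (Finset.univ_nonempty (α := s.range)) f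
        have h1 : φ x ≤ f i + c i x := Finset.inf'_le _ (Finset.mem_univ i)
        have h2 : l = f i := hi
        linarith [hc1 i x]
      have hφf (i : s.range) : φ i ≤ f i := by
        have h1 : φ i ≤ f i + c i i := Finset.inf'_le _ (Finset.mem_univ i)
        linarith [hself i]
      have hφg (j : s.range) : -g j ≤ φ j := Finset.le_inf' _ _ fun i _ => by
        linarith [hfg i j]
      have hφm : Measurable φ := by
        refine Continuous.measurable (Continuous.finset_inf'_apply _ fun i _ => ?_)
        exact continuous_const.add (hcont.comp (Continuous.prodMk_right (i : X)))
      have hφi (ρ : Measure X) [IsProbabilityMeasure ρ] (u : X → X) (hu : Measurable u) :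
          Integrable (fun x => φ (u x)) ρ :=
        Integrable.of_bound (hφm.comp hu).aestronglyMeasurable (|l| + 1) (ae_of_all _ fun x => by
          rw [Real.norm_eq_abs, abs_le]
          constructor <;> linarith [hφ0 (u x), hφ1 (u x), le_abs_self l, neg_abs_le l])
      have hφi' (ρ : Measure X) [IsProbabilityMeasure ρ] : Integrable φ ρ :=
        hφi ρ id measurable_id
      have h1 : ∫ x, (φ x - l) ∂ν - ∫ x, (φ x - l) ∂μ ≤ r :=
        hdual (fun x => φ x - l) (fun x => by linarith [hφ0 x]) (fun x => by linarith [hφ1 x])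
          fun x y => by linarith [hφc x y]
      rw [integral_sub (hφi' ν) (integrable_const l),
        integral_sub (hφi' μ) (integrable_const l)] at h1
      simp only [integral_const, probReal_univ, one_smul] at h1
      have h2 : ∫ x, φ x ∂μ - ∫ x, φ (s x) ∂μ ≤ ∫ x, c x (s x) ∂μ := by
        rw [← integral_sub (hφi' μ) (hφi μ s s.measurable)]
        refine integral_mono ((hφi' μ).sub (hφi μ s s.measurable)) (hint μ)
          fun x => ?_
        rw [hsymm]
        exact hφc _ _
      have h3 : ∫ x, φ (s x) ∂ν - ∫ x, φ x ∂ν ≤ ∫ x, c x (s x) ∂ν := by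
        rw [← integral_sub (hφi ν s s.measurable) (hφi' ν)]
        exact integral_mono ((hφi ν s s.measurable).sub (hφi' ν)) (hint ν)
          fun x => hφc _ _
      have h4 : ∫ x, φ (s x) ∂μ ≤ ∑ i, f i * μ.real (s ⁻¹' {i.1}) := by
        rw [hsum]
        exact Finset.sum_le_sum fun i _ => mul_le_mul_of_nonneg_right (hφf i) measureReal_nonneg
      have h5 : -∫ x, φ (s x) ∂ν ≤ ∑ i, g i * ν.real (s ⁻¹' {i.1}) := by
        rw [hsum, ← Finset.sum_neg_distrib]
        refine Finset.sum_le_sum fun i _ => ?_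
        rw [← neg_mul]
        exact mul_le_mul_of_nonneg_right (by linarith [hφg i]) measureReal_nonneg
      linarith)
  obtain ⟨π, hπ, hπc⟩ := exists_coupling_of_simpleFunc μ ν s m hm hmμ hmν
    fun x y => ENNReal.ofReal (c x y)
  refine ⟨π, hπ, ?_⟩
  have hmar (ρ : Measure X) [IsProbabilityMeasure ρ] (hρ : ∫ x, c x (s x) ∂ρ < ε / 4) :
      ∫⁻ x, ENNReal.ofReal (c x (s x)) ∂ρ ≤ ENNReal.ofReal (ε / 4) := by
    rw [← ofReal_integral_eq_lintegral_ofReal (hint ρ) (ae_of_all _ fun x => hc0 _ _)]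
    exact ENNReal.ofReal_le_ofReal hρ.le
  have hcost0 : 0 ≤ ∑ i, ∑ j, m i j * c i j :=
    Finset.sum_nonneg fun i _ => Finset.sum_nonneg fun j _ => mul_nonneg (hm i j) (hc0 _ _)
  have hms : Measurable fun x => ENNReal.ofReal (c x (s x)) := hcs.ennreal_ofReal
  have hm1 : Measurable fun p : X × X => ENNReal.ofReal (c p.1 (s p.1)) :=
    hms.comp measurable_fst
  have hm2 : Measurable fun p : X × X => ENNReal.ofReal (c p.2 (s p.2)) :=
    hms.comp measurable_snd
  have hm12 : Measurable fun p : X × X =>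
      ENNReal.ofReal (c p.1 (s p.1)) + ENNReal.ofReal (c p.2 (s p.2)) := hm1.add hm2
  have hπ1 : ∫⁻ p, ENNReal.ofReal (c p.1 (s p.1)) ∂π = ∫⁻ x, ENNReal.ofReal (c x (s x)) ∂μ := by
    rw [← lintegral_map hms measurable_fst, hπ.1]
  have hπ2 : ∫⁻ p, ENNReal.ofReal (c p.2 (s p.2)) ∂π = ∫⁻ x, ENNReal.ofReal (c x (s x)) ∂ν := by
    rw [← lintegral_map hms measurable_snd, hπ.2]
  calc ∫⁻ p, ENNReal.ofReal (c p.1 p.2) ∂π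
      ≤ ∫⁻ p, (ENNReal.ofReal (c p.1 (s p.1)) + ENNReal.ofReal (c p.2 (s p.2)))
          + ENNReal.ofReal (c (s p.1) (s p.2)) ∂π := by
        refine lintegral_mono fun p => ?_
        rw [← ENNReal.ofReal_add (hc0 _ _) (hc0 _ _),
          ← ENNReal.ofReal_add (add_nonneg (hc0 _ _) (hc0 _ _)) (hc0 _ _)]
        refine ENNReal.ofReal_le_ofReal ?_
        linarith [htri p.1 (s p.1) p.2, htri (s p.1) (s p.2) p.2, hsymm p.2 (s p.2)]
    _ = ∫⁻ x, ENNReal.ofReal (c x (s x)) ∂μ + ∫⁻ x, ENNReal.ofReal (c x (s x)) ∂ν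
          + ∑ i, ∑ j, ENNReal.ofReal (m i j) * ENNReal.ofReal (c i j) := by
        rw [lintegral_add_left hm12, lintegral_add_left hm1, hπc, hπ1, hπ2]
    _ ≤ ENNReal.ofReal (ε / 4) + ENNReal.ofReal (ε / 4) + ENNReal.ofReal (r + ε / 2) := by
        gcongr
        · exact hmar μ hNμ
        · exact hmar ν hNν
        · simp_rw [← ENNReal.ofReal_mul (hm _ _)]
          simp_rw [← ENNReal.ofReal_sum_of_nonneg fun j _ => mul_nonneg (hm _ j) (hc0 _ _)]
          rw [← ENNReal.ofReal_sum_of_nonneg fun i _ =>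
            Finset.sum_nonneg fun j _ => mul_nonneg (hm i j) (hc0 _ _)]
          exact ENNReal.ofReal_le_ofReal hcost
    _ = ENNReal.ofReal (r + ε) := by
        rw [← ENNReal.ofReal_add (by positivity) (by positivity),
          ← ENNReal.ofReal_add (by positivity) (hcost0.trans hcost)]
        congr 1
        ring

/-- A mollification at scale `r` of a `[0,1]`-valued continuous function, with local control of
its oscillation. -/
theorem exists_contDiff_mollification {E : Type*} [NormedAddCommGroup E] [NormedSpace ℝ E]
    [FiniteDimensional ℝ E] {f : E → ℝ} (hf : Continuous f) (hf0 : ∀ x, 0 ≤ f x)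
    (hf1 : ∀ x, f x ≤ 1) {r : ℝ} (hr : 0 < r) :
    ∃ g : E → ℝ, ContDiff ℝ 1 g ∧ (∀ x, |g x| ≤ 1) ∧
      (∀ x M, (∀ t ∈ Metric.ball (0 : E) r, |f (x - t) - f x| ≤ M) → |g x - f x| ≤ M) ∧
      ∀ a b M, (∀ t ∈ Metric.ball (0 : E) r, |f (b - t) - f (a - t)| ≤ M) → |g b - g a| ≤ M := by
  borelize E
  let φ : ContDiffBump (0 : E) := ⟨r / 2, r, by positivity, by linarith⟩
  set μ : Measure E := Measure.addHaar
  have hint (u : E → ℝ) (hu : Continuous u) : Integrable (fun t => φ.normed μ t * u t) μ :=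
    (φ.continuous_normed.mul hu).integrable_of_hasCompactSupport
      φ.hasCompactSupport_normed.mul_right
  have hbd (u : E → ℝ) (M : ℝ) (hM : ∀ t ∈ Metric.ball (0 : E) r, |u t| ≤ M) :
      |∫ t, φ.normed μ t * u t ∂μ| ≤ M := by
    have h1 : ∫ t, φ.normed μ t * M ∂μ = M := by
      rw [integral_mul_const, φ.integral_normed, one_mul]
    rw [← h1, ← Real.norm_eq_abs]
    refine norm_integral_le_of_norm_le (hint _ continuous_const) (ae_of_all _ fun t => ?_)
    rw [norm_mul, Real.norm_eq_abs, Real.norm_eq_abs, abs_of_nonneg (φ.nonneg_normed t)]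
    by_cases ht : t ∈ Metric.ball (0 : E) r
    · exact mul_le_mul_of_nonneg_left (hM t ht) (φ.nonneg_normed t)
    · have : φ.normed μ t = 0 := by
        rw [← Function.notMem_support, φ.support_normed_eq]
        exact ht
      simp [this]
  have hfx (x : E) : Continuous fun t => f (x - t) := hf.comp (by fun_prop)
  refine ⟨fun x => ∫ t, φ.normed μ t * f (x - t) ∂μ, ?_, fun x => ?_, fun x M hM => ?_,
    fun a b M hM => ?_⟩
  · exact φ.hasCompactSupport_normed.contDiff_convolution_left (ContinuousLinearMap.lsmul ℝ ℝ)
      φ.contDiff_normed hf.locallyIntegrable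
  · exact hbd _ 1 fun t _ => by
      rw [abs_of_nonneg (hf0 _)]
      exact hf1 _
  · have h1 : ∫ t, φ.normed μ t * f x ∂μ = f x := by
      rw [integral_mul_const, φ.integral_normed, one_mul]
    have h2 := hbd (fun t => f (x - t) - f x) M hM
    simp_rw [mul_sub] at h2
    rwa [integral_sub (hint _ (hfx x)) (hint _ continuous_const), h1] at h2
  · have h2 := hbd (fun t => f (b - t) - f (a - t)) M hM
    simp_rw [mul_sub] at h2
    rwa [integral_sub (hint _ (hfx b)) (hint _ (hfx a))] at h2

/-- The `[0,1]`-valued functions whose slope is controlled by `κ V`. -/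
def slopeClass {H : Type*} [NormedAddCommGroup H] [NormedSpace ℝ H] (V : H → ℝ) (κ : ℝ) :
    Set (H → ℝ) :=
  {φ | (∀ z, 0 ≤ φ z) ∧ (∀ z, φ z ≤ 1) ∧ ∀ z z' M, (∀ w ∈ segment ℝ z z', V w ≤ M) →
    φ z' - φ z ≤ κ * (M * ‖z' - z‖)}

theorem slopeClass.abs_sub_le {H : Type*} [NormedAddCommGroup H] [NormedSpace ℝ H] {V : H → ℝ}
    {κ : ℝ} {φ : H → ℝ} (hφ : φ ∈ slopeClass V κ) {z z' : H} {M : ℝ}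
    (hM : ∀ w ∈ segment ℝ z z', V w ≤ M) : |φ z' - φ z| ≤ κ * (M * ‖z' - z‖) := by
  rw [abs_le]
  have h1 := hφ.2.2 z z' M hM
  have h2 := hφ.2.2 z' z M (by rwa [segment_symm])
  rw [norm_sub_rev] at h2
  constructor <;> linarith

theorem slopeClass.lipschitz {H : Type*} [NormedAddCommGroup H] [NormedSpace ℝ H] {V : H → ℝ}
    {κ N : ℝ} (hκ : 0 ≤ κ) (hN : 0 ≤ N) {φ : H → ℝ} (hφ : φ ∈ slopeClass V κ)
    (hV : ∀ z, V z ≤ N) : LipschitzWith (κ * N).toNNReal φ := by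
  refine LipschitzWith.of_dist_le_mul fun z z' => ?_
  rw [Real.coe_toNNReal _ (mul_nonneg hκ hN), dist_comm, Real.dist_eq, dist_comm, dist_eq_norm,
    mul_assoc]
  exact slopeClass.abs_sub_le hφ fun w _ => hV w

/-- Smooth approximation of functions of controlled slope, uniformly controlled off a set of small
measure. -/
theorem exists_smooth_approx {H : Type*} [NormedAddCommGroup H] [InnerProductSpace ℝ H]
    [CompleteSpace H] [SecondCountableTopology H] [MeasurableSpace H] [BorelSpace H]
    {V : H → ℝ} (hV : Continuous V) (hV1 : ∀ z, 1 ≤ V z) {N : ℝ} (hVN : ∀ z, V z ≤ N)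
    {κ : ℝ} (hκ : 0 < κ) {φ : H → ℝ} (hφ : φ ∈ slopeClass V κ) (l : Measure H)
    [IsFiniteMeasure l] {ε : ℝ} (hε : 0 < ε) :
    ∃ ψ : H → ℝ, ContDiff ℝ 1 ψ ∧ (∀ x, |ψ x| ≤ 1) ∧ (∃ M, ∀ x, ‖fderiv ℝ ψ x‖ ≤ M) ∧
      ∫ x, |ψ x - φ x| ∂l ≤ ε ∧ ∃ h : H → ℝ, Measurable h ∧ (∀ x, 0 ≤ h x) ∧
        (∃ B, ∀ x, h x ≤ B) ∧ ∫ x, h x ∂l ≤ ε ∧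
        ∀ x, ‖fderiv ℝ ψ x‖ ^ 2 ≤ 4 * κ ^ 2 * V x ^ 2 + h x := by
  have hN : 1 ≤ N := (hV1 0).trans (hVN 0)
  set A := κ * N with hA
  have hA0 : 0 < A := by positivity
  have hφc : Continuous φ := (slopeClass.lipschitz hκ.le (by linarith) hφ hVN).continuous
  have hφA (z z' : H) : |φ z' - φ z| ≤ A * ‖z' - z‖ := by
    rw [hA, mul_assoc]
    exact slopeClass.abs_sub_le hφ fun w _ => hVN w
  obtain ⟨K, hK, hKl⟩ := isTightMeasureSet_iff_exists_isCompact_measure_compl_le.1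
    (isTightMeasureSet_singleton (μ := l)) (ENNReal.ofReal (ε / (4 + A ^ 2)))
    (by rw [ENNReal.ofReal_pos]; positivity)
  have hKl : l.real Kᶜ ≤ ε / (4 + A ^ 2) :=
    ENNReal.toReal_le_of_le_ofReal (by positivity) (hKl l rfl)
  have hKl' : (4 + A ^ 2) * l.real Kᶜ ≤ ε := by
    rwa [le_div_iff₀ (by positivity), mul_comm] at hKl
  obtain ⟨r₀, hr₀, hr₀V⟩ := Metric.mem_uniformity_dist.1 (hK.uniformContinuousAt_of_continuousAt V
    (fun a _ => hV.continuousAt) (Metric.dist_mem_uniformity one_pos))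
  have hVK {z w : H} (hz : z ∈ K) (hw : dist z w < r₀) : V w ≤ 2 * V z := by
    have h1 : dist (V z) (V w) < 1 := hr₀V hw hz
    rw [Real.dist_eq, abs_lt] at h1
    linarith [hV1 z]
  set r := min (r₀ / 3) (ε / (4 * A * (l.real Set.univ + 1))) with hr
  have hr0 : 0 < r := by positivity
  have hrr : 3 * r ≤ r₀ := by linarith [min_le_left (r₀ / 3) (ε / (4 * A * (l.real Set.univ + 1)))]
  have hrε : 2 * A * r * l.real Set.univ ≤ ε / 2 := by
    have h1 : r ≤ ε / (4 * A * (l.real Set.univ + 1)) := min_le_right _ _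
    rw [le_div_iff₀ (by positivity)] at h1
    nlinarith [mul_pos hA0 hr0]
  obtain ⟨t, htK, htf, ht⟩ := hK.finite_cover_balls hr0
  set E : Submodule ℝ H := Submodule.span ℝ t with hE
  have : FiniteDimensional ℝ E := FiniteDimensional.span_of_finite ℝ htf
  set Q : H →L[ℝ] E := E.orthogonalProjectionOnto with hQ
  have hQ1 (z z' : H) : ‖Q z' - Q z‖ ≤ ‖z' - z‖ := by
    rw [← map_sub]
    exact E.norm_orthogonalProjectionOnto_apply_le _
  have hQK {z : H} (hz : z ∈ K) : ‖z - Q z‖ < r := by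
    obtain ⟨x, hx, hzx⟩ := Set.mem_iUnion₂.1 (ht hz)
    rw [Metric.mem_ball, dist_eq_norm] at hzx
    refine lt_of_le_of_lt ?_ hzx
    have h1 := E.starProjection_minimal z
    have h2 : ‖z - Q z‖ = ‖z - E.starProjection z‖ := rfl
    rw [h2, h1]
    exact ciInf_le ⟨0, by rintro _ ⟨y, rfl⟩; exact norm_nonneg _⟩
      (⟨x, Submodule.subset_span hx⟩ : E)
  obtain ⟨g, hg, hg1, hgf, hgd⟩ := exists_contDiff_mollification (f := fun e : E => φ e)
    (hφc.comp continuous_subtype_val) (fun _ => hφ.1 _) (fun _ => hφ.2.1 _) hr0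
  have hψ : ContDiff ℝ 1 fun z => g (Q z) := hg.comp Q.contDiff
  have hfd (z : H) : ‖fderiv ℝ (fun z => g (Q z)) z‖ ≤ A := by
    refine norm_fderiv_le_of_lip' ℝ hA0.le (Eventually.of_forall fun z' => ?_)
    rw [Real.norm_eq_abs]
    refine hgd _ _ _ fun s _ => (hφA _ _).trans ?_
    refine mul_le_mul_of_nonneg_left (le_trans (le_of_eq ?_) (hQ1 z z')) hA0.le
    simp only [AddSubgroupClass.coe_sub, Submodule.coe_norm]
    congr 1
    abel
  have hfdK {z : H} (hz : z ∈ K) : ‖fderiv ℝ (fun z => g (Q z)) z‖ ≤ 2 * κ * V z := by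
    have hVz := hV1 z
    refine norm_fderiv_le_of_lip' ℝ (by positivity) ?_
    filter_upwards [Metric.ball_mem_nhds z hr0] with z' hz'
    rw [Metric.mem_ball, dist_eq_norm] at hz'
    rw [Real.norm_eq_abs]
    refine hgd _ _ _ fun s hs => ?_
    rw [mem_ball_zero_iff] at hs
    have hball : segment ℝ ((Q z - s : E) : H) ((Q z' - s : E) : H) ⊆ Metric.ball z r₀ := by
      refine (convex_ball z r₀).segment_subset ?_ ?_
      · rw [Metric.mem_ball, dist_eq_norm]
        calc ‖((Q z - s : E) : H) - z‖ = ‖-(z - Q z) - s‖ := by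
              congr 1; push_cast; abel
          _ ≤ ‖z - Q z‖ + ‖(s : H)‖ := by
              rw [← norm_neg (z - Q z)]; exact norm_sub_le _ _
          _ < r + r := add_lt_add (hQK hz) hs
          _ ≤ r₀ := by linarith
      · rw [Metric.mem_ball, dist_eq_norm]
        calc ‖((Q z' - s : E) : H) - z‖ = ‖((Q z' - Q z : E) : H) - (z - Q z) - s‖ := by
              congr 1; push_cast; abel
          _ ≤ ‖((Q z' - Q z : E) : H)‖ + ‖z - Q z‖ + ‖(s : H)‖ :=
              (norm_sub_le _ _).trans (add_le_add_left (norm_sub_le _ _) _)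
          _ < r + r + r :=
              add_lt_add (add_lt_add ((hQ1 z z').trans_lt hz') (hQK hz)) hs
          _ ≤ r₀ := by linarith
    refine (slopeClass.abs_sub_le hφ fun w hw => hVK hz (by
      rw [dist_comm]; exact hball hw)).trans ?_
    have h3 : ‖((Q z' - s : E) : H) - ((Q z - s : E) : H)‖ ≤ ‖z' - z‖ := by
      refine le_trans (le_of_eq ?_) (hQ1 z z')
      rw [Submodule.coe_norm]
      congr 1
      push_cast
      abel
    nlinarith [mul_le_mul_of_nonneg_left h3 (by positivity : 0 ≤ κ * (2 * V z))]
  refine ⟨fun z => g (Q z), hψ, fun _ => hg1 _, ⟨A, hfd⟩, ?_, Kᶜ.indicator fun _ => A ^ 2,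
    measurable_const.indicator hK.measurableSet.compl,
    fun x => Set.indicator_nonneg (fun _ _ => by positivity) x,
    ⟨A ^ 2, fun x => Set.indicator_le_self' (fun _ _ => by positivity) x⟩, ?_, fun x => ?_⟩
  · have h1 : ∀ x, |g (Q x) - φ x| ≤ 2 * A * r + Kᶜ.indicator (fun _ => 2) x := by
      intro x
      by_cases hx : x ∈ K
      · rw [Set.indicator_of_notMem (by simpa using hx), add_zero]
        have h2 : |g (Q x) - φ (Q x)| ≤ A * r := hgf _ _ fun s hs => by
          refine (hφA _ _).trans (mul_le_mul_of_nonneg_left ?_ hA0.le)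
          rw [mem_ball_zero_iff] at hs
          have : ((Q x - s : E) : H) - (Q x : H) = -(s : H) := by push_cast; abel
          rw [this, norm_neg]
          exact hs.le
        have h3 : |φ (Q x) - φ x| ≤ A * r := by
          refine (hφA _ _).trans (mul_le_mul_of_nonneg_left ?_ hA0.le)
          rw [norm_sub_rev]
          exact (hQK hx).le
        have h4 := abs_sub_le (g (Q x)) (φ (Q x)) (φ x)
        linarith
      · rw [Set.indicator_of_mem (by simpa using hx)]
        have h2 := abs_sub (g (Q x)) (φ x)
        have h3 : |φ x| ≤ 1 := by rw [abs_of_nonneg (hφ.1 x)]; exact hφ.2.1 x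
        have := hg1 (Q x)
        nlinarith [mul_pos hA0 hr0]
    have hi : Integrable (Kᶜ.indicator fun _ => (2 : ℝ)) l :=
      (integrable_const _).indicator hK.measurableSet.compl
    calc ∫ x, |g (Q x) - φ x| ∂l
        ≤ ∫ x, (2 * A * r + Kᶜ.indicator (fun _ => 2) x) ∂l :=
          integral_mono_of_nonneg (ae_of_all _ fun x => abs_nonneg _)
            ((integrable_const _).add hi) (ae_of_all _ h1)
      _ = 2 * A * r * l.real Set.univ + 2 * l.real Kᶜ := by
          rw [integral_add (integrable_const _) hi,
            integral_indicator_const _ hK.measurableSet.compl]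
          simp [mul_comm]
      _ ≤ ε := by nlinarith [sq_nonneg A, measureReal_nonneg (μ := l) (s := Kᶜ)]
  · rw [integral_indicator_const _ hK.measurableSet.compl, smul_eq_mul]
    nlinarith [sq_nonneg A, measureReal_nonneg (μ := l) (s := Kᶜ)]
  · by_cases hx : x ∈ K
    · rw [Set.indicator_of_notMem (by simpa using hx), add_zero]
      have := pow_le_pow_left₀ (norm_nonneg _) (hfdK hx) 2
      nlinarith
    · rw [Set.indicator_of_mem (by simpa using hx)]
      have := pow_le_pow_left₀ (norm_nonneg _) (hfd x) 2
      nlinarith [sq_nonneg (κ * V x)]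

section ArcCost

variable {H : Type*} [NormedAddCommGroup H]

/-- The costs `∫₀^ℓ V(g(t)) dt` of the arcs `g` of speed at most one from `a` to `z`. -/
def arcCosts (V : H → ℝ) (a z : H) : Set ℝ :=
  {r | ∃ (g : ℝ → H) (ℓ : ℝ), LipschitzWith 1 g ∧ 0 ≤ ℓ ∧ g 0 = a ∧ g ℓ = z ∧
    r = ∫ t in (0:ℝ)..ℓ, V (g t)}

theorem arcCosts_bddBelow {V : H → ℝ} (hV : ∀ z, 0 ≤ V z) (a z : H) :
    BddBelow (arcCosts V a z) := by
  refine ⟨0, ?_⟩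
  rintro _ ⟨g, ℓ, -, hℓ, -, -, rfl⟩
  exact intervalIntegral.integral_nonneg hℓ fun t _ => hV _

theorem sInf_arcCosts_self {V : H → ℝ} (hV : ∀ z, 0 ≤ V z) (a : H) :
    sInf (arcCosts V a a) ≤ 0 :=
  csInf_le (arcCosts_bddBelow hV a a)
    ⟨fun _ => a, 0, LipschitzWith.const' a, le_rfl, rfl, rfl, by simp⟩

variable [NormedSpace ℝ H]

/-- Prolonging an arc by a segment. -/
theorem exists_arcCosts_le_add {V : H → ℝ} (hVc : Continuous V) {a z z' : H} {M r : ℝ}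
    (hM : ∀ w ∈ segment ℝ z z', V w ≤ M) (hr : r ∈ arcCosts V a z) :
    ∃ r' ∈ arcCosts V a z', r' ≤ r + M * ‖z' - z‖ := by
  obtain ⟨g, ℓ, hg, hℓ, hg0, hgℓ, rfl⟩ := hr
  rcases eq_or_ne z' z with rfl | hne
  · exact ⟨_, ⟨g, ℓ, hg, hℓ, hg0, hgℓ, rfl⟩, by simp⟩
  set d := ‖z' - z‖ with hd
  have hd0 : 0 < d := norm_pos_iff.2 (sub_ne_zero.2 hne)
  set u : H := d⁻¹ • (z' - z) with hu
  have hu1 : ‖u‖ = 1 := by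
    rw [hu, norm_smul, norm_inv, norm_norm, inv_mul_cancel₀ hd0.ne']
  set g' : ℝ → H := fun t => g (min t ℓ) + (t - min t ℓ) • u with hg'
  have hlip : LipschitzWith 1 g' := by
    refine LipschitzWith.of_dist_le_mul fun s t => ?_
    have h1 : dist (g (min s ℓ)) (g (min t ℓ)) ≤ |min s ℓ - min t ℓ| := by
      simpa [Real.dist_eq] using hg.dist_le_mul (min s ℓ) (min t ℓ)
    have h2 : dist ((s - min s ℓ) • u) ((t - min t ℓ) • u)
        = |(s - min s ℓ) - (t - min t ℓ)| := by
      rw [dist_eq_norm, ← sub_smul, norm_smul, hu1, mul_one, Real.norm_eq_abs]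
    have h3 : |min s ℓ - min t ℓ| + |(s - min s ℓ) - (t - min t ℓ)| = |s - t| := by
      rcases le_total s t with h | h
      · have h4 : min s ℓ ≤ min t ℓ := min_le_min_right _ h
        have h5 : s - min s ℓ ≤ t - min t ℓ := by
          rcases le_total s ℓ with h6 | h6
          · rw [min_eq_left h6]
            linarith [min_le_left t ℓ]
          · rw [min_eq_right h6, min_eq_right (h6.trans h)]
            linarith
        rw [abs_of_nonpos (by linarith), abs_of_nonpos (by linarith), abs_of_nonpos (by linarith)]
        ring
      · have h4 : min t ℓ ≤ min s ℓ := min_le_min_right _ h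
        have h5 : t - min t ℓ ≤ s - min s ℓ := by
          rcases le_total t ℓ with h6 | h6
          · rw [min_eq_left h6]
            linarith [min_le_left s ℓ]
          · rw [min_eq_right h6, min_eq_right (h6.trans h)]
            linarith
        rw [abs_of_nonneg (by linarith), abs_of_nonneg (by linarith), abs_of_nonneg (by linarith)]
        ring
    rw [NNReal.coe_one, one_mul, Real.dist_eq, ← h3, ← h2]
    exact (dist_add_add_le _ _ _ _).trans (add_le_add_left h1 _)
  have hi (x y : ℝ) : IntervalIntegrable (fun t => V (g' t)) volume x y :=
    (hVc.comp hlip.continuous).intervalIntegrable _ _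
  refine ⟨_, ⟨g', ℓ + d, hlip, by positivity, ?_, ?_, rfl⟩, ?_⟩
  · simp [hg', min_eq_left hℓ, hg0]
  · simp only [hg']
    rw [min_eq_right (by linarith), hgℓ, hu, add_sub_cancel_left, smul_smul,
      mul_inv_cancel₀ hd0.ne', one_smul]
    abel
  · rw [← intervalIntegral.integral_add_adjacent_intervals (hi 0 ℓ) (hi ℓ (ℓ + d))]
    refine add_le_add (le_of_eq (intervalIntegral.integral_congr fun t ht => ?_)) ?_
    · rw [Set.uIcc_of_le hℓ] at ht
      simp [hg', min_eq_left ht.2]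
    · have h1 : ∫ t in ℓ..(ℓ + d), V (g' t) ≤ ∫ _ in ℓ..(ℓ + d), M := by
        refine intervalIntegral.integral_mono_on (by linarith) (hi _ _) (by simp) fun t ht => hM _ ?_
        refine segment_eq_image' ℝ z z' ▸ ⟨(t - ℓ) / d, ⟨?_, ?_⟩, ?_⟩
        · exact div_nonneg (by linarith [ht.1]) hd0.le
        · rw [div_le_one hd0]
          linarith [ht.2]
        · simp only [hg']
          rw [min_eq_right ht.1, hgℓ, hu, smul_smul, div_eq_mul_inv]
      refine h1.trans (le_of_eq ?_)
      rw [intervalIntegral.integral_const, smul_eq_mul]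
      ring

theorem arcCosts_nonempty {V : H → ℝ} (hVc : Continuous V) (a z : H) :
    (arcCosts V a z).Nonempty := by
  have hseg : IsCompact (segment ℝ a z) := by
    rw [segment_eq_image']
    exact isCompact_Icc.image (by fun_prop)
  obtain ⟨M, hM⟩ := (hseg.image hVc).bddAbove
  obtain ⟨r, hr, -⟩ := exists_arcCosts_le_add hVc (a := a) (z := a) (z' := z) (M := M) (r := 0)
    (fun w hw => hM ⟨w, hw, rfl⟩)
    ⟨fun _ => a, 0, LipschitzWith.const' a, le_rfl, rfl, rfl, by simp⟩
  exact ⟨r, hr⟩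

theorem min_sInf_arcCosts_mem_slopeClass {V : H → ℝ} (hVc : Continuous V) (hV : ∀ z, 0 ≤ V z)
    (a : H) {κ : ℝ} (hκ : 0 < κ) :
    (fun z => min 1 (κ * sInf (arcCosts V a z))) ∈ slopeClass V κ := by
  refine ⟨fun z => le_min zero_le_one (mul_nonneg hκ.le (Real.sInf_nonneg ?_)),
    fun z => min_le_left _ _, fun z z' M hM => ?_⟩
  · rintro _ ⟨g, ℓ, -, hℓ, -, -, rfl⟩
    exact intervalIntegral.integral_nonneg hℓ fun t _ => hV _
  · have h1 : sInf (arcCosts V a z') - M * ‖z' - z‖ ≤ sInf (arcCosts V a z) := by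
      refine le_csInf (arcCosts_nonempty hVc a z) fun r hr => ?_
      obtain ⟨r', hr', hle⟩ := exists_arcCosts_le_add hVc hM hr
      linarith [csInf_le (arcCosts_bddBelow hV a z') hr']
    have h2 : 0 ≤ M * ‖z' - z‖ :=
      mul_nonneg ((hV z).trans (hM z (left_mem_segment ℝ z z'))) (norm_nonneg _)
    have h3 := mul_le_mul_of_nonneg_left h1 hκ.le
    have h4 := mul_nonneg hκ.le h2
    rcases min_cases 1 (κ * sInf (arcCosts V a z)) with ⟨h5, -⟩ | ⟨h5, -⟩ <;> simp only [h5]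
    · linarith [min_le_left 1 (κ * sInf (arcCosts V a z'))]
    · linarith [min_le_right 1 (κ * sInf (arcCosts V a z'))]

theorem rhoP_bddBelow {W : H → ℝ} (hW : ∀ z, 1 ≤ W z) (p : ℝ) (x y : H) :
    BddBelow {r : ℝ | ∃ γ : ℝ → H, (∃ K : ℝ≥0, LipschitzWith K γ) ∧ γ 0 = x ∧ γ 1 = y ∧
      r = ∫ t in (0:ℝ)..1, W (γ t) ^ p * ‖deriv γ t‖} := by
  refine ⟨0, ?_⟩
  rintro _ ⟨γ, -, -, -, rfl⟩
  exact intervalIntegral.integral_nonneg zero_le_one fun t _ =>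
    mul_nonneg (Real.rpow_nonneg (by linarith [hW (γ t)]) _) (norm_nonneg _)

theorem rhoP_le_of_arc {W : H → ℝ} (hWc : Continuous W) (hW : ∀ z, 1 ≤ W z) (p : ℝ)
    {g : ℝ → H} (hg : LipschitzWith 1 g) {ℓ : ℝ} (hℓ : 0 ≤ ℓ) :
    rhoP W p (g 0) (g ℓ) ≤ ∫ t in (0:ℝ)..ℓ, W (g t) ^ p := by
  set u : ℝ → H := fun t => g (ℓ * t) with hu
  have hul : LipschitzWith ℓ.toNNReal u := by
    refine LipschitzWith.of_dist_le_mul fun s t => (hg.dist_le_mul _ _).trans (le_of_eq ?_)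
    rw [NNReal.coe_one, one_mul, Real.coe_toNNReal _ hℓ, Real.dist_eq, Real.dist_eq, ← mul_sub,
      abs_mul, abs_of_nonneg hℓ]
  have hc : Continuous fun t => W (u t) ^ p :=
    (hWc.comp hul.continuous).rpow_const fun t => Or.inl (by linarith [hW (u t)] : W (u t) ≠ 0)
  calc rhoP W p (g 0) (g ℓ) ≤ ∫ t in (0:ℝ)..1, W (u t) ^ p * ‖deriv u t‖ :=
        csInf_le (rhoP_bddBelow hW p _ _) ⟨u, ⟨_, hul⟩, by simp [hu], by simp [hu], rfl⟩
    _ ≤ ∫ t in (0:ℝ)..1, W (u t) ^ p * ℓ := by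
        rw [intervalIntegral.integral_of_le zero_le_one, intervalIntegral.integral_of_le zero_le_one]
        refine integral_mono_of_nonneg (ae_of_all _ fun t => ?_)
          ((hc.mul continuous_const).integrableOn_Ioc) (ae_of_all _ fun t => ?_)
        · exact mul_nonneg (Real.rpow_nonneg (by linarith [hW (u t)]) _) (norm_nonneg _)
        · refine mul_le_mul_of_nonneg_left ?_ (Real.rpow_nonneg (by linarith [hW (u t)]) _)
          simpa [Real.coe_toNNReal _ hℓ] using norm_deriv_le_of_lipschitz hul (x₀ := t)
    _ = ∫ t in (0:ℝ)..ℓ, W (g t) ^ p := by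
        rw [intervalIntegral.integral_mul_const, mul_comm]
        have := intervalIntegral.smul_integral_comp_mul_left (a := 0) (b := 1)
          (fun t => W (g t) ^ p) ℓ
        simpa [hu] using this

end ArcCost

section Penalization

variable {H : Type*} [NormedAddCommGroup H]

/-- A penalization of the distance to the sets `K j`, `j < n`. -/
def penalty (K : ℕ → Set H) (n : ℕ) (z : H) : ℝ :=
  ∑ j ∈ Finset.range n, (j : ℝ) * min 1 (Metric.infDist z (K j))

/-- A bounded continuous substitute for `W ^ p`, penalized away from the sets `K j`. -/
def penalizedWeight (W : H → ℝ) (p : ℝ) (K : ℕ → Set H) (n : ℕ) (z : H) : ℝ :=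
  min (W z) (n + 1) ^ p + penalty K n z

theorem min_infDist_nonneg (s : Set H) (z : H) : 0 ≤ min 1 (Metric.infDist z s) :=
  le_min zero_le_one Metric.infDist_nonneg

theorem penalty_nonneg (K : ℕ → Set H) (n : ℕ) (z : H) : 0 ≤ penalty K n z :=
  Finset.sum_nonneg fun j _ => mul_nonneg j.cast_nonneg (min_infDist_nonneg _ _)

theorem continuous_penalty (K : ℕ → Set H) (n : ℕ) : Continuous (penalty K n) :=
  continuous_finsetSum _ fun j _ =>
    continuous_const.mul (continuous_const.min (Metric.continuous_infDist_pt (K j)))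

theorem penalty_le (K : ℕ → Set H) (n : ℕ) (z : H) : penalty K n z ≤ n ^ 2 := by
  calc penalty K n z ≤ ∑ _j ∈ Finset.range n, (n : ℝ) := by
        refine Finset.sum_le_sum fun j hj => ?_
        have h1 : (j : ℝ) ≤ n := by exact_mod_cast (Finset.mem_range.1 hj).le
        nlinarith [min_infDist_nonneg (K j) z, min_le_left 1 (Metric.infDist z (K j)),
          (j.cast_nonneg : (0 : ℝ) ≤ j)]
    _ = n ^ 2 := by simp [sq]

theorem penalty_sq_le (K : ℕ → Set H) (n : ℕ) (z : H) :
    penalty K n z ^ 2 ≤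
      ∑ j ∈ Finset.range n, (2 * (j : ℝ) ^ 3 + j ^ 2) * min 1 (Metric.infDist z (K j)) := by
  induction n with
  | zero => simp [penalty]
  | succ n ih =>
    have h1 : penalty K (n + 1) z = penalty K n z + n * min 1 (Metric.infDist z (K n)) :=
      Finset.sum_range_succ _ _
    rw [Finset.sum_range_succ, h1]
    have h2 := penalty_le K n z
    have h3 := min_infDist_nonneg (K n) z
    have h4 := min_le_left 1 (Metric.infDist z (K n))
    set m := min 1 (Metric.infDist z (K n))
    have hn : (0 : ℝ) ≤ n := n.cast_nonneg
    have h5 : penalty K n z * (n * m) ≤ n ^ 2 * (n * m) :=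
      mul_le_mul_of_nonneg_right h2 (by positivity)
    have h6 : (n * m) ^ 2 ≤ (n : ℝ) ^ 2 * m := by
      rw [mul_pow]
      exact mul_le_mul_of_nonneg_left (by nlinarith) (by positivity)
    nlinarith

theorem one_le_penalizedWeight {W : H → ℝ} (hW : ∀ z, 1 ≤ W z) {p : ℝ} (hp : 0 ≤ p)
    (K : ℕ → Set H) (n : ℕ) (z : H) : 1 ≤ penalizedWeight W p K n z := by
  have h1 : (1 : ℝ) ≤ min (W z) (n + 1) := le_min (hW z) (by simp)
  have := Real.one_le_rpow h1 hp
  unfold penalizedWeight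
  linarith [penalty_nonneg K n z]

theorem continuous_penalizedWeight {W : H → ℝ} (hWc : Continuous W) {p : ℝ} (hp : 0 ≤ p)
    (K : ℕ → Set H) (n : ℕ) : Continuous (penalizedWeight W p K n) :=
  ((hWc.min continuous_const).rpow_const fun _ => Or.inr hp).add (continuous_penalty K n)

theorem penalizedWeight_le {W : H → ℝ} (hW : ∀ z, 1 ≤ W z) {p : ℝ} (hp : 0 ≤ p)
    (K : ℕ → Set H) (n : ℕ) (z : H) :
    penalizedWeight W p K n z ≤ (n + 1 : ℝ) ^ p + n ^ 2 := by
  refine add_le_add (Real.rpow_le_rpow ?_ (min_le_right _ _) hp) (penalty_le K n z)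
  exact zero_le_one.trans (le_min (hW z) (by simp))

theorem penalizedWeight_sq_le {W : H → ℝ} (hW : ∀ z, 1 ≤ W z) {p : ℝ} (hp : 0 ≤ p)
    (K : ℕ → Set H) (n : ℕ) (z : H) :
    penalizedWeight W p K n z ^ 2 ≤ 2 * W z ^ (2 * p) + 2 * penalty K n z ^ 2 := by
  have h0 : 0 ≤ min (W z) (n + 1) := zero_le_one.trans (le_min (hW z) (by simp))
  have h1 : min (W z) (n + 1) ^ p ≤ W z ^ p := Real.rpow_le_rpow h0 (min_le_left _ _) hp
  have h2 : W z ^ (2 * p) = (W z ^ p) ^ 2 := by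
    rw [mul_comm, Real.rpow_mul (by linarith [hW z])]
    norm_cast
  have h3 := pow_le_pow_left₀ (Real.rpow_nonneg h0 p) h1 2
  rw [h2]
  unfold penalizedWeight
  nlinarith [sq_nonneg (min (W z) (n + 1) ^ p - penalty K n z)]

/-- Arcs of bounded penalized cost stay close to the sets `K j`. -/
theorem infDist_lt_of_arc {W : H → ℝ} (hWc : Continuous W) (hW : ∀ z, 1 ≤ W z) {p : ℝ}
    (hp : 0 ≤ p) {K : ℕ → Set H} (hK : ∀ j, K 0 ⊆ K j) {L r : ℝ} (hr : 0 < r) (hr1 : r ≤ 1)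
    {j n : ℕ} (hjn : j < n) (hjL : L < j * (r / 2) ^ 2) {g : ℝ → H} (hg : LipschitzWith 1 g)
    (hg0 : g 0 ∈ K 0) {ℓ s : ℝ} (hs : s ∈ Set.Icc 0 ℓ)
    (hcost : ∫ t in (0:ℝ)..ℓ, penalizedWeight W p K n (g t) ≤ L) :
    Metric.infDist (g s) (K j) < r := by
  by_contra! hge
  have hdist (u v : ℝ) : dist (g u) (g v) ≤ |u - v| := by
    simpa [Real.dist_eq] using hg.dist_le_mul u v
  have hrs : r ≤ s := by
    have h1 := hge.trans (Metric.infDist_le_dist_of_mem (hK j hg0))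
    have h2 := hdist s 0
    rw [sub_zero, abs_of_nonneg hs.1] at h2
    linarith
  have hcont := (continuous_penalizedWeight hWc hp K n).comp hg.continuous
  have hlow : ∀ t ∈ Set.Icc (s - r / 2) s, j * (r / 2) ≤ penalizedWeight W p K n (g t) := by
    intro t ht
    have h1 : r / 2 ≤ Metric.infDist (g t) (K j) := by
      have h2 := Metric.infDist_le_infDist_add_dist (s := K j) (x := g s) (y := g t)
      have h3 := hdist s t
      rw [abs_of_nonneg (by linarith [ht.2])] at h3
      linarith [ht.1]
    have h4 : j * (r / 2) ≤ penalty K n (g t) :=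
      le_trans (mul_le_mul_of_nonneg_left (le_min (by linarith) h1) j.cast_nonneg)
        (Finset.single_le_sum (f := fun j : ℕ => (j : ℝ) * min 1 (Metric.infDist (g t) (K j)))
          (fun i _ => mul_nonneg i.cast_nonneg (min_infDist_nonneg _ _)) (Finset.mem_range.2 hjn))
    have h5 : 0 ≤ min (W (g t)) (n + 1) ^ p :=
      Real.rpow_nonneg (zero_le_one.trans (le_min (hW _) (by simp))) _
    unfold penalizedWeight
    linarith
  have h1 : ∫ _ in (s - r / 2)..s, (j * (r / 2) : ℝ) ≤
      ∫ t in (s - r / 2)..s, penalizedWeight W p K n (g t) :=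
    intervalIntegral.integral_mono_on (by linarith) (by simp) (hcont.intervalIntegrable _ _) hlow
  have h2 : ∫ t in (s - r / 2)..s, penalizedWeight W p K n (g t) ≤
      ∫ t in (0:ℝ)..ℓ, penalizedWeight W p K n (g t) :=
    intervalIntegral.integral_mono_interval (by linarith) (by linarith) hs.2
      (ae_of_all _ fun t => zero_le_one.trans (one_le_penalizedWeight hW hp K n _))
      (hcont.intervalIntegrable _ _)
  rw [intervalIntegral.integral_const, smul_eq_mul] at h1
  nlinarith

/-- Arcs of bounded penalized cost stay in a region where the truncation of `W` is inactive. -/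
theorem exists_arc_weight_le [CompleteSpace H] {W : H → ℝ} (hWc : Continuous W)
    (hW : ∀ z, 1 ≤ W z) {p : ℝ} (hp : 0 ≤ p) {K : ℕ → Set H} (hKc : ∀ j, IsCompact (K j))
    (hK : ∀ j, K 0 ⊆ K j) (L : ℝ) :
    ∃ n : ℕ, ∀ g : ℝ → H, LipschitzWith 1 g → g 0 ∈ K 0 → ∀ ℓ : ℝ,
      ∫ t in (0:ℝ)..ℓ, penalizedWeight W p K n (g t) ≤ L → ∀ s ∈ Set.Icc 0 ℓ, W (g s) ≤ n + 1 := by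
  by_contra! hcon
  choose g hg hg0 ℓ hcost s hs hbig using hcon
  set w : ℕ → H := fun n => g n (s n) with hw
  have htb : TotallyBounded (Set.range w) := by
    refine Metric.totallyBounded_iff.2 fun ε hε => ?_
    set r := min (ε / 2) 1 with hr
    have hr0 : 0 < r := by positivity
    obtain ⟨j, hj⟩ := exists_nat_gt (L / (r / 2) ^ 2)
    rw [div_lt_iff₀ (by positivity)] at hj
    obtain ⟨t, ht, hcov⟩ := Metric.totallyBounded_iff.1 (hKc j).totallyBounded (ε / 2)
      (by positivity)
    refine ⟨t ∪ w '' Set.Iic j, ht.union ((Set.finite_Iic j).image w), ?_⟩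
    rintro _ ⟨n, rfl⟩
    rcases le_or_gt n j with hn | hn
    · exact Set.mem_iUnion₂.2 ⟨w n, Or.inr ⟨n, hn, rfl⟩, Metric.mem_ball_self hε⟩
    · have h1 : Metric.infDist (w n) (K j) < r := infDist_lt_of_arc hWc hW hp hK hr0
        (min_le_right _ _) hn hj (hg n) (hg0 n) (hs n) (hcost n)
      obtain ⟨y, hy, hwy⟩ := (Metric.infDist_lt_iff ⟨g n 0, hK j (hg0 n)⟩).1 h1
      obtain ⟨x, hx, hyx⟩ := Set.mem_iUnion₂.1 (hcov hy)
      refine Set.mem_iUnion₂.2 ⟨x, Or.inl hx, ?_⟩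
      rw [Metric.mem_ball] at hyx ⊢
      linarith [dist_triangle (w n) y x, min_le_left (ε / 2) 1]
  obtain ⟨M, hM⟩ := (((htb.closure).isCompact_of_isClosed isClosed_closure).image hWc).bddAbove
  obtain ⟨n, hn⟩ := exists_nat_gt M
  have h1 : W (w n) ≤ M := hM ⟨w n, subset_closure ⟨n, rfl⟩, rfl⟩
  linarith [hbig n]

theorem exists_slopeClass_rhoP_le [NormedSpace ℝ H] [CompleteSpace H] {W : H → ℝ}
    (hWc : Continuous W) (hW : ∀ z, 1 ≤ W z) {p : ℝ} (hp : 0 ≤ p) {K : ℕ → Set H}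
    (hKc : ∀ j, IsCompact (K j)) (hK : ∀ j, K 0 ⊆ K j) {κ : ℝ} (hκ : 0 < κ) :
    ∃ n : ℕ, ∀ a ∈ K 0, ∃ f ∈ slopeClass (penalizedWeight W p K n) κ,
      f a = 0 ∧ ∀ b, min 1 (κ * rhoP W p a b) ≤ f b := by
  obtain ⟨n, hn⟩ := exists_arc_weight_le hWc hW hp hKc hK κ⁻¹
  set V := penalizedWeight W p K n with hV
  have hVc : Continuous V := continuous_penalizedWeight hWc hp K n
  have hV0 (z) : 0 ≤ V z := zero_le_one.trans (one_le_penalizedWeight hW hp K n z)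
  refine ⟨n, fun a ha => ⟨_, min_sInf_arcCosts_mem_slopeClass hVc hV0 a hκ, ?_, fun b => ?_⟩⟩
  · have h1 := (min_sInf_arcCosts_mem_slopeClass hVc hV0 a hκ).1 a
    have h2 := mul_le_mul_of_nonneg_left (sInf_arcCosts_self hV0 a) hκ.le
    rw [mul_zero] at h2
    exact le_antisymm ((min_le_right _ _).trans h2) h1
  · refine le_min (min_le_left _ _) ?_
    rw [← div_le_iff₀' hκ]
    refine le_csInf (arcCosts_nonempty hVc a b) ?_
    rintro r ⟨g, ℓ, hg, hℓ, rfl, rfl, rfl⟩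
    rw [div_le_iff₀' hκ]
    rcases le_or_gt (∫ t in (0:ℝ)..ℓ, V (g t)) κ⁻¹ with h | h
    · refine (min_le_right _ _).trans (mul_le_mul_of_nonneg_left ?_ hκ.le)
      refine (rhoP_le_of_arc hWc hW p hg hℓ).trans ?_
      refine intervalIntegral.integral_mono_on hℓ ?_
        ((hVc.comp hg.continuous).intervalIntegrable _ _) fun t ht => ?_
      · exact ((hWc.comp hg.continuous).rpow_const fun _ => Or.inr hp).intervalIntegrable _ _
      · simp only [hV, penalizedWeight, min_eq_left (hn g hg ha ℓ h t ht)]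
        linarith [penalty_nonneg K n (g t)]
    · refine (min_le_left _ _).trans ?_
      have := mul_le_mul_of_nonneg_left h.le hκ.le
      rwa [mul_inv_cancel₀ hκ.ne'] at this

end Penalization

/-- Approximate duality between couplings and functions of controlled slope. -/
theorem exists_coupling_of_slopeClass_bound {H : Type*} [NormedAddCommGroup H] [NormedSpace ℝ H]
    [SecondCountableTopology H] [MeasurableSpace H] [BorelSpace H] (μ ν : Measure H)
    [IsProbabilityMeasure μ] [IsProbabilityMeasure ν] {V : H → ℝ} (hV : ∀ z, 0 ≤ V z) {N : ℝ}
    (hVN : ∀ z, V z ≤ N) {κ : ℝ} (hκ : 0 ≤ κ) (r : ℝ)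
    (hr : ∀ φ ∈ slopeClass V κ, ∫ x, φ x ∂ν - ∫ x, φ x ∂μ ≤ r) {ε : ℝ} (hε : 0 < ε) :
    ∃ c : H → H → ℝ, (∀ φ ∈ slopeClass V κ, ∀ a b, φ b - φ a ≤ c a b) ∧
      Measurable (fun p : H × H => c p.1 p.2) ∧
      ∃ π : Measure (H × H), IsCoupling π μ ν ∧
        ∫⁻ p, ENNReal.ofReal (c p.1 p.2) ∂π ≤ ENNReal.ofReal (r + ε) := by
  have hN : 0 ≤ N := (hV 0).trans (hVN 0)
  have hzero : (fun _ => 0 : H → ℝ) ∈ slopeClass V κ := by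
    refine ⟨fun _ => le_rfl, fun _ => zero_le_one, fun z z' M hM => ?_⟩
    have := (hV z).trans (hM z (left_mem_segment ℝ z z'))
    rw [sub_zero]
    positivity
  have : Nonempty (slopeClass V κ) := ⟨⟨_, hzero⟩⟩
  set c : H → H → ℝ := fun a b => ⨆ φ : slopeClass V κ, (φ.1 b - φ.1 a) with hc
  have hbdd (a b : H) : BddAbove (Set.range fun φ : slopeClass V κ => φ.1 b - φ.1 a) := by
    refine ⟨1, ?_⟩
    rintro _ ⟨φ, rfl⟩
    linarith [φ.2.1 a, φ.2.2.1 b]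
  have hle : ∀ φ ∈ slopeClass V κ, ∀ a b, φ b - φ a ≤ c a b := fun φ hφ a b =>
    le_ciSup (hbdd a b) ⟨φ, hφ⟩
  have hc0 (a b : H) : 0 ≤ c a b := by simpa using hle _ hzero a b
  have hself (a : H) : c a a = 0 := by simp [hc]
  have hsymm' (a b : H) : c a b ≤ c b a := ciSup_le fun φ => by
    have h1 : (fun z => 1 - φ.1 z) ∈ slopeClass V κ := by
      refine ⟨fun z => by linarith [φ.2.2.1 z], fun z => by linarith [φ.2.1 z],
        fun z z' M hM => ?_⟩
      have := φ.2.2.2 z' z M (by rwa [segment_symm])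
      rw [norm_sub_rev] at this
      linarith
    linarith [hle _ h1 b a]
  have htri (a b d : H) : c a d ≤ c a b + c b d := ciSup_le fun φ => by
    linarith [hle _ φ.2 a b, hle _ φ.2 b d]
  have hlip (a b : H) : c a b ≤ κ * (N * ‖b - a‖) := ciSup_le fun φ =>
    φ.2.2.2 a b N fun w _ => hVN w
  have hunif (a : H) : Tendsto (fun b => c a b) (𝓝 a) (𝓝 0) := by
    refine squeeze_zero (fun b => hc0 a b) (fun b => hlip a b) ?_
    have h1 : Continuous fun b : H => κ * (N * ‖b - a‖) := by fun_prop
    simpa using h1.tendsto a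
  have hsymm (a b : H) : c a b = c b a := le_antisymm (hsymm' a b) (hsymm' b a)
  refine ⟨c, hle, ?_, ?_⟩
  · refine Continuous.measurable (continuous_iff_continuousAt.2 fun p => ?_)
    refine tendsto_iff_dist_tendsto_zero.2 ?_
    have h1 := ((hunif p.1).comp (continuous_fst.tendsto p)).add
      ((hunif p.2).comp (continuous_snd.tendsto p))
    rw [add_zero] at h1
    refine squeeze_zero (fun _ => dist_nonneg) (fun q => ?_) h1
    rw [Real.dist_eq, abs_le]
    have h2 := htri q.1 p.1 q.2
    have h3 := htri p.1 p.2 q.2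
    have h4 := htri p.1 q.1 p.2
    have h5 := htri q.1 q.2 p.2
    have h6 := hsymm q.1 p.1
    have h7 := hsymm q.2 p.2
    constructor <;> simp only [Function.comp] <;> linarith
  · refine exists_coupling_of_dual_bound μ ν c hc0 (fun a b => ciSup_le fun φ => ?_) hself hsymm
      htri hunif r (fun φ h0 h1 h2 => hr φ ⟨h0, h1, fun z z' M hM => ?_⟩) ε hε
    · linarith [φ.2.1 a, φ.2.2.1 b]
    · exact (h2 z z').trans (ciSup_le fun φ => φ.2.2.2 z z' M hM)

theorem integral_penalty_sq_le {H : Type*} [NormedAddCommGroup H] [MeasurableSpace H]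
    [BorelSpace H] (l : Measure H) [IsFiniteMeasure l] {K : ℕ → Set H}
    (hK : ∀ j, MeasurableSet (K j)) {η : ℝ} (hη : 0 ≤ η)
    (hl : ∀ j : ℕ, (2 * (j : ℝ) ^ 3 + j ^ 2) * l.real (K j)ᶜ ≤ η / 2 / 2 ^ j) (n : ℕ) :
    ∫ z, penalty K n z ^ 2 ∂l ≤ η := by
  have hi (j : ℕ) : Integrable (fun z => (2 * (j : ℝ) ^ 3 + j ^ 2) *
      min 1 (Metric.infDist z (K j))) l := by
    refine Integrable.const_mul (Integrable.of_bound (Continuous.aestronglyMeasurable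
      (continuous_const.min (Metric.continuous_infDist_pt (K j)))) 1 (ae_of_all _ fun z => ?_)) _
    rw [Real.norm_eq_abs, abs_of_nonneg (min_infDist_nonneg _ _)]
    exact min_le_left _ _
  have hle (j : ℕ) : ∫ z, min 1 (Metric.infDist z (K j)) ∂l ≤ l.real (K j)ᶜ := by
    rw [← integral_indicator_one (hK j).compl]
    refine integral_mono_of_nonneg (ae_of_all _ fun z => min_infDist_nonneg _ _)
      ((integrable_const _).indicator (hK j).compl) (ae_of_all _ fun z => ?_)
    by_cases hz : z ∈ K j
    · simp [hz, Metric.infDist_zero_of_mem hz]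
    · simp [hz]
  calc ∫ z, penalty K n z ^ 2 ∂l
      ≤ ∫ z, ∑ j ∈ Finset.range n, (2 * (j : ℝ) ^ 3 + j ^ 2) * min 1 (Metric.infDist z (K j)) ∂l :=
        integral_mono_of_nonneg (ae_of_all _ fun z => sq_nonneg _)
          (integrable_finsetSum _ fun j _ => hi j) (ae_of_all _ fun z => penalty_sq_le K n z)
    _ = ∑ j ∈ Finset.range n, (2 * (j : ℝ) ^ 3 + j ^ 2) * ∫ z, min 1 (Metric.infDist z (K j)) ∂l := by
        rw [integral_finsetSum _ fun j _ => hi j]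
        simp_rw [integral_const_mul]
    _ ≤ ∑ j ∈ Finset.range n, η / 2 / 2 ^ j := Finset.sum_le_sum fun j _ =>
        (mul_le_mul_of_nonneg_left (hle j) (by positivity)).trans (hl j)
    _ ≤ ∑' j : ℕ, η / 2 / 2 ^ j :=
        (summable_geometric_two' η).sum_le_tsum _ fun j _ => by positivity
    _ = η := tsum_geometric_two' η

/-- Compact sets for which the penalty is small in mean square. -/
theorem exists_compacts_penalty_le {H : Type*} [NormedAddCommGroup H] [CompleteSpace H]
    [SecondCountableTopology H] [MeasurableSpace H] [BorelSpace H] (l : Measure H)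
    [IsFiniteMeasure l] {η : ℝ} (hη : 0 < η) :
    ∃ K : ℕ → Set H, (∀ j, IsCompact (K j)) ∧ (∀ j, K 0 ⊆ K j) ∧ l.real (K 0)ᶜ ≤ η ∧
      ∀ n, ∫ z, penalty K n z ^ 2 ∂l ≤ η := by
  have hcpt (e : ℝ) (he : 0 < e) : ∃ K : Set H, IsCompact K ∧ l.real Kᶜ ≤ e := by
    obtain ⟨K, hK, hKl⟩ := isTightMeasureSet_iff_exists_isCompact_measure_compl_le.1
      (isTightMeasureSet_singleton (μ := l)) (ENNReal.ofReal e) (by rwa [ENNReal.ofReal_pos])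
    exact ⟨K, hK, ENNReal.toReal_le_of_le_ofReal he.le (hKl l rfl)⟩
  choose K hK hKl using fun j : ℕ =>
    hcpt (η / 2 / 2 ^ j / (2 * (j : ℝ) ^ 3 + j ^ 2 + 1)) (by positivity)
  have hl (j : ℕ) : l.real (K 0 ∪ K j)ᶜ ≤ η / 2 / 2 ^ j / (2 * (j : ℝ) ^ 3 + j ^ 2 + 1) :=
    (measureReal_mono (Set.compl_subset_compl.2 Set.subset_union_right)).trans (hKl j)
  refine ⟨fun j => K 0 ∪ K j, fun j => (hK 0).union (hK j), fun j => ?_, ?_, fun n => ?_⟩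
  · simp
  · refine (hl 0).trans ?_
    norm_num
    linarith
  · refine integral_penalty_sq_le l (fun j => ((hK 0).union (hK j)).measurableSet) hη.le
      (fun j => ?_) n
    have h1 := hl j
    rw [le_div_iff₀ (by positivity)] at h1
    nlinarith [measureReal_nonneg (μ := l) (s := (K 0 ∪ K j)ᶜ)]

theorem locallyLipschitz_of_norm_fderiv_le {H : Type*} [NormedAddCommGroup H] [NormedSpace ℝ H]
    {Φ A : H → ℝ} (hΦ : Differentiable ℝ Φ) (hA : Continuous A)
    (hΦA : ∀ z, ‖fderiv ℝ Φ z‖ ≤ A z) : LocallyLipschitz Φ := by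
  intro z
  obtain ⟨r, hr, hball⟩ := Metric.mem_nhds_iff.1
    (hA.continuousAt.eventually (gt_mem_nhds (lt_add_one (A z))))
  refine ⟨(A z + 1).toNNReal, Metric.ball z r, Metric.ball_mem_nhds z hr,
    (convex_ball z r).lipschitzOnWith_of_nnnorm_fderiv_le (𝕜 := ℝ) (fun x _ => hΦ x) fun x hx => ?_⟩
  have h1 : A x < A z + 1 := hball hx
  rw [← NNReal.coe_le_coe, coe_nnnorm]
  exact ((hΦA x).trans h1.le).trans (Real.le_coe_toNNReal _)

/-- The increment of a function along a Lipschitz path. -/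
theorem sub_le_integral_of_norm_fderiv_le {H : Type*} [NormedAddCommGroup H]
    [InnerProductSpace ℝ H] [CompleteSpace H] [SecondCountableTopology H]
    {Φ A : H → ℝ} (hΦ : Differentiable ℝ Φ) (hA : Continuous A)
    (hΦA : ∀ z, ‖fderiv ℝ Φ z‖ ≤ A z) {γ : ℝ → H} {L : ℝ≥0} (hγ : LipschitzWith L γ)
    {g : ℝ → ℝ} (hg : IntervalIntegrable g volume 0 1)
    (hΦg : ∀ t ∈ Set.Icc (0 : ℝ) 1, ‖fderiv ℝ Φ (γ t)‖ * ‖deriv γ t‖ ≤ g t) :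
    Φ (γ 1) - Φ (γ 0) ≤ ∫ t in (0:ℝ)..1, g t := by
  have hloc : LocallyLipschitz (Φ ∘ γ) :=
    (locallyLipschitz_of_norm_fderiv_le hΦ hA hΦA).comp hγ.locallyLipschitz
  obtain ⟨B, hB⟩ := LocallyLipschitzOn.exists_lipschitzOnWith_of_compact
    (isCompact_Icc (a := (0 : ℝ)) (b := 1)) hloc.locallyLipschitzOn
  rw [← Set.uIcc_of_le (zero_le_one : (0 : ℝ) ≤ 1)] at hB
  have hac := hB.absolutelyContinuousOnInterval
  have h1 := hac.integral_deriv_eq_sub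
  simp only [Function.comp_apply] at h1
  rw [← h1]
  refine intervalIntegral.integral_mono_ae_restrict zero_le_one hac.intervalIntegrable_deriv hg ?_
  filter_upwards [ae_restrict_of_ae hγ.ae_differentiableAt_hilbert,
    ae_restrict_mem measurableSet_Icc] with t ht htI
  rw [((hΦ (γ t)).hasFDerivAt.comp_hasDerivAt t ht.hasDerivAt).deriv]
  exact (Real.le_norm_self _).trans ((ContinuousLinearMap.le_opNorm _ _).trans (hΦg t htI))

/-- The combination of a gradient bound and of a super-Lyapunov bound for a single kernel. -/
theorem gradient_bound_of_moment_bound {H : Type*} [NormedAddCommGroup H] [NormedSpace ℝ H]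
    [MeasurableSpace H] [BorelSpace H] (m : Measure H) [IsProbabilityMeasure m] {W D F : H → ℝ}
    (hWc : Continuous W) (hW : ∀ z, 1 ≤ W z) {p w : ℝ} (hp : 1 < p) (hw : 1 ≤ w) {Ct : ℝ}
    (hCt : 0 < Ct)
    (hWp : ∫⁻ y, ENNReal.ofReal (W y ^ (2 * p)) ∂m ≤ ENNReal.ofReal (Ct * w ^ (2 * p - 2)))
    (hF : Integrable F m) (hF0 : ∀ z, 0 ≤ F z) {κ : ℝ}
    (hκ : 0 < κ) (hDF : ∀ z, D z ^ 2 ≤ 8 * κ ^ 2 * W z ^ (2 * p) + F z) :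
    √(∫ z, D z ^ 2 ∂m) ≤ 3 * κ * √Ct * w ^ (p - 1) + κ + κ⁻¹ * ∫ z, F z ∂m := by
  have hWcp : Continuous fun y => W y ^ (2 * p) :=
    hWc.rpow_const fun z => Or.inr (by linarith)
  have hW0 (z) : 0 ≤ W z ^ (2 * p) := Real.rpow_nonneg (zero_le_one.trans (hW z)) _
  have hWi : Integrable (fun y => W y ^ (2 * p)) m := by
    refine ⟨hWcp.aestronglyMeasurable, ?_⟩
    rw [hasFiniteIntegral_iff_ofReal (ae_of_all _ hW0)]
    exact hWp.trans_lt ENNReal.ofReal_lt_top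
  have hw0 : 0 ≤ w ^ (p - 1) := Real.rpow_nonneg (zero_le_one.trans hw) _
  have hws : w ^ (2 * p - 2) = (w ^ (p - 1)) ^ 2 := by
    rw [← Real.rpow_natCast, ← Real.rpow_mul (zero_le_one.trans hw)]
    congr 1
    push_cast
    ring
  have hWint : ∫ y, W y ^ (2 * p) ∂m ≤ Ct * (w ^ (p - 1)) ^ 2 := by
    rw [← hws, ← ENNReal.ofReal_le_ofReal_iff (by rw [hws]; positivity),
      ofReal_integral_eq_lintegral_ofReal hWi (ae_of_all _ hW0)]
    exact hWp
  have hI : 0 ≤ ∫ z, F z ∂m := integral_nonneg hF0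
  set I := ∫ z, F z ∂m
  have h1 : ∫ z, D z ^ 2 ∂m ≤ 8 * κ ^ 2 * (Ct * (w ^ (p - 1)) ^ 2) + I := by
    calc ∫ z, D z ^ 2 ∂m ≤ ∫ z, (8 * κ ^ 2 * W z ^ (2 * p) + F z) ∂m :=
          integral_mono_of_nonneg (ae_of_all _ fun _ => sq_nonneg _)
            ((hWi.const_mul _).add hF) (ae_of_all _ hDF)
      _ = 8 * κ ^ 2 * ∫ y, W y ^ (2 * p) ∂m + I := by
          rw [integral_add (hWi.const_mul _) hF, integral_const_mul]
      _ ≤ _ := by gcongr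
  refine Real.sqrt_le_iff.2 ⟨by positivity, h1.trans ?_⟩
  have h2 : 0 ≤ κ⁻¹ * I := by positivity
  have h3 : κ * (κ⁻¹ * I) = I := by field_simp
  have h4 : 0 ≤ 3 * κ * √Ct * w ^ (p - 1) := by positivity
  have h5 : (3 * κ * √Ct * w ^ (p - 1)) ^ 2 = 9 * κ ^ 2 * (Ct * (w ^ (p - 1)) ^ 2) := by
    rw [mul_pow, mul_pow, mul_pow, Real.sq_sqrt hCt.le]
    ring
  have h6 : 0 ≤ κ ^ 2 * (Ct * (w ^ (p - 1)) ^ 2) := by positivity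
  nlinarith [mul_nonneg h4 hκ.le, mul_nonneg h4 h2]

/-- The gradient of `Qψ` under a gradient bound and a super-Lyapunov bound for `Q`. -/
theorem norm_fderiv_integral_kernel_le {H : Type*} [NormedAddCommGroup H] [NormedSpace ℝ H]
    [MeasurableSpace H] [BorelSpace H] {Q : Kernel H H} [IsMarkovKernel Q] {W F ψ : H → ℝ}
    (hWc : Continuous W) (hW : ∀ z, 1 ≤ W z) {p C Ct e : ℝ} (hp : 1 < p) (hC : 0 < C)
    (hCt : 0 < Ct) (he : 0 ≤ e) (heC : e * (3 * √Ct + 1) ≤ 1 / 4) (z : H)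
    (hgrad : ‖fderiv ℝ (fun z => ∫ y, ψ y ∂(Q z)) z‖ ≤
      W z * (e * √(∫ y, ‖fderiv ℝ ψ y‖ ^ 2 ∂(Q z)) + C * (⨆ y, |ψ y|)))
    (hsuper : ∫⁻ y, ENNReal.ofReal (W y ^ (2 * p)) ∂(Q z)
      ≤ ENNReal.ofReal (Ct * W z ^ (2 * p - 2)))
    (hψ : ∀ y, |ψ y| ≤ 1) (hF : Integrable F (Q z)) (hF0 : ∀ y, 0 ≤ F y)
    (hψF : ∀ y, ‖fderiv ℝ ψ y‖ ^ 2 ≤ 8 * (4 * C) ^ 2 * W y ^ (2 * p) + F y) :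
    ‖fderiv ℝ (fun z => ∫ y, ψ y ∂(Q z)) z‖ ≤
      2 * C * W z ^ p + (4 * C)⁻¹ * W z * ∫ y, F y ∂(Q z) := by
  have hsup : ⨆ y, |ψ y| ≤ 1 := ciSup_le hψ
  have hsqrt := gradient_bound_of_moment_bound (Q z) hWc hW hp (hW z) hCt hsuper hF hF0
    (by positivity : 0 < 4 * C) hψF
  have hW0 : 0 < W z := zero_lt_one.trans_le (hW z)
  have hI : 0 ≤ ∫ y, F y ∂(Q z) := integral_nonneg hF0
  set I := ∫ y, F y ∂(Q z)
  have hwp : W z ^ p = W z * W z ^ (p - 1) := by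
    rw [Real.rpow_sub_one hW0.ne']
    field_simp
  have hw1 : 1 ≤ W z ^ (p - 1) := Real.one_le_rpow (hW z) (by linarith)
  rw [hwp]
  set w := W z ^ (p - 1)
  have he1 : e ≤ 1 := by nlinarith [Real.sqrt_nonneg Ct]
  have hCI : 0 ≤ (4 * C)⁻¹ * I := by positivity
  have key : e * √(∫ y, ‖fderiv ℝ ψ y‖ ^ 2 ∂(Q z)) + C * (⨆ y, |ψ y|) ≤
      2 * C * w + (4 * C)⁻¹ * I := by
    calc e * √(∫ y, ‖fderiv ℝ ψ y‖ ^ 2 ∂(Q z)) + C * (⨆ y, |ψ y|)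
        ≤ e * (3 * (4 * C) * √Ct * w + 4 * C + (4 * C)⁻¹ * I) + C * 1 := by gcongr
      _ ≤ e * (3 * (4 * C) * √Ct * w + 4 * C * w + (4 * C)⁻¹ * I) + C * w := by
          have h4 : 4 * C ≤ 4 * C * w := le_mul_of_one_le_right (by positivity) hw1
          have h5 : C ≤ C * w := le_mul_of_one_le_right hC.le hw1
          rw [mul_one]
          exact add_le_add (mul_le_mul_of_nonneg_left (by linarith) he) h5
      _ = e * (3 * √Ct + 1) * (4 * C * w) + C * w + e * ((4 * C)⁻¹ * I) := by ring
      _ ≤ 1 / 4 * (4 * C * w) + C * w + 1 * ((4 * C)⁻¹ * I) := by gcongr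
      _ = _ := by ring
  calc _ ≤ W z * (2 * C * w + (4 * C)⁻¹ * I) := hgrad.trans (by gcongr)
    _ = _ := by ring

/-- Integrating along a path and then against a kernel amounts to integrating against the
mixture of the kernel along the path. -/
theorem integral_integral_kernel_path {H : Type*} [TopologicalSpace H] [MeasurableSpace H]
    [BorelSpace H] (Q : Kernel H H) [IsMarkovKernel Q] {γ : ℝ → H} (hγ : Continuous γ)
    {F : H → ℝ} (hF : Measurable F) (hF0 : ∀ z, 0 ≤ F z) {b : ℝ} (hFb : ∀ z, F z ≤ b) :
    IntervalIntegrable (fun t => ∫ z, F z ∂(Q (γ t))) volume 0 1 ∧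
      ∫ t in (0:ℝ)..1, ∫ z, F z ∂(Q (γ t)) =
        ∫ z, F z ∂(((volume.restrict (Set.Ioc (0:ℝ) 1)).map γ).bind Q) := by
  have hint (m : Measure H) [IsFiniteMeasure m] : Integrable F m :=
    Integrable.of_bound hF.aestronglyMeasurable b
      (ae_of_all _ fun z => by rw [Real.norm_of_nonneg (hF0 z)]; exact hFb z)
  have hsm : StronglyMeasurable fun t => ∫ z, F z ∂(Q (γ t)) :=
    (hF.stronglyMeasurable.integral_kernel (κ := Q)).comp_measurable hγ.measurable
  have hI0 (t) : 0 ≤ ∫ z, F z ∂(Q (γ t)) := integral_nonneg hF0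
  refine ⟨?_, ?_⟩
  · rw [intervalIntegrable_iff_integrableOn_Ioc_of_le zero_le_one]
    refine Integrable.of_bound hsm.aestronglyMeasurable b (ae_of_all _ fun t => ?_)
    rw [Real.norm_of_nonneg (hI0 t)]
    exact (integral_mono (hint _) (integrable_const b) hFb).trans (by simp)
  · rw [intervalIntegral.integral_of_le zero_le_one,
      integral_eq_lintegral_of_nonneg_ae (ae_of_all _ hI0) hsm.aestronglyMeasurable,
      integral_eq_lintegral_of_nonneg_ae (ae_of_all _ hF0) hF.aestronglyMeasurable,
      Measure.lintegral_bind Q.aemeasurable hF.ennreal_ofReal.aemeasurable,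
      lintegral_map hF.ennreal_ofReal.lintegral_kernel hγ.measurable]
    simp_rw [fun t => ofReal_integral_eq_lintegral_ofReal (hint (Q (γ t))) (ae_of_all _ hF0)]

/-- The mixture over `t ∈ [0, 1]` of the measures `Q (γ t)`. -/
def pathMixture {H : Type*} [MeasurableSpace H] (Q : Kernel H H) (γ : ℝ → H) : Measure H :=
  ((volume.restrict (Set.Ioc (0:ℝ) 1)).map γ).bind Q

instance {H : Type*} [MeasurableSpace H] (Q : Kernel H H) [IsMarkovKernel Q] (γ : ℝ → H) :
    IsFiniteMeasure (pathMixture Q γ) :=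
  inferInstanceAs (IsFiniteMeasure (((volume.restrict (Set.Ioc (0:ℝ) 1)).map γ).bind Q))

/-- A kernel `Q` satisfies the gradient bound with weight `W` and constants `e` and `C`. -/
def GradientBound {H : Type*} [NormedAddCommGroup H] [NormedSpace ℝ H] [MeasurableSpace H]
    (Q : Kernel H H) (W : H → ℝ) (e C : ℝ) : Prop :=
  ∀ φ : H → ℝ, ContDiff ℝ 1 φ → (∃ M, ∀ x, |φ x| ≤ M) → (∃ M, ∀ x, ‖fderiv ℝ φ x‖ ≤ M) →
    Differentiable ℝ (fun x => ∫ y, φ y ∂(Q x)) ∧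
    ∀ x : H, ‖fderiv ℝ (fun z => ∫ y, φ y ∂(Q z)) x‖ ≤
      W x * (e * √(∫ y, ‖fderiv ℝ φ y‖ ^ 2 ∂(Q x)) + C * (⨆ z : H, |φ z|))

theorem intervalIntegrable_weight_mul_norm_deriv {H : Type*} [NormedAddCommGroup H]
    [InnerProductSpace ℝ H] [CompleteSpace H] [SecondCountableTopology H] {W : H → ℝ} {p : ℝ}
    (hWc : Continuous W) (hW : ∀ z, 1 ≤ W z)
    {γ : ℝ → H} {L : ℝ≥0} (hγ : LipschitzWith L γ) :
    IntervalIntegrable (fun t => W (γ t) ^ p * ‖deriv γ t‖) volume 0 1 := by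
  have hc : Continuous fun t => W (γ t) ^ p :=
    (hWc.comp hγ.continuous).rpow_const fun t => Or.inl (zero_lt_one.trans_le (hW _)).ne'
  have hd : IntervalIntegrable (fun t => ‖deriv γ t‖) volume 0 1 := by
    rw [intervalIntegrable_iff_integrableOn_Ioc_of_le zero_le_one]
    refine Integrable.of_bound (stronglyMeasurable_deriv γ).norm.aestronglyMeasurable L
      (ae_of_all _ fun t => ?_)
    rw [norm_norm]
    exact norm_deriv_le_of_lipschitz hγ
  exact hd.continuousOn_mul hc.continuousOn

section PathEstimates

variable {H : Type*} [NormedAddCommGroup H] [InnerProductSpace ℝ H] [CompleteSpace H]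
  [SecondCountableTopology H] [MeasurableSpace H] [BorelSpace H] {Q : Kernel H H}
  [IsMarkovKernel Q] {W : H → ℝ} {p C Ct e : ℝ}

/-- The increment of `Qψ` along a path. -/
theorem integral_sub_le_of_gradientBound (hWc : Continuous W) (hW : ∀ z, 1 ≤ W z) (hp : 1 < p)
    (hC : 0 < C) (hCt : 0 < Ct) (he : 0 ≤ e) (heC : e * (3 * √Ct + 1) ≤ 1 / 4)
    (hgrad : GradientBound Q W e C)
    (hsuper : ∀ x, ∫⁻ y, ENNReal.ofReal (W y ^ (2 * p)) ∂(Q x)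
      ≤ ENNReal.ofReal (Ct * W x ^ (2 * p - 2)))
    {γ : ℝ → H} {L : ℝ≥0} (hγ : LipschitzWith L γ) {B : ℝ}
    (hB : ∀ t ∈ Set.Icc (0:ℝ) 1, (4 * C)⁻¹ * W (γ t) * ‖deriv γ t‖ ≤ B) {ψ F : H → ℝ}
    (hψ : ContDiff ℝ 1 ψ) (hψ1 : ∀ y, |ψ y| ≤ 1) (hψM : ∃ M, ∀ y, ‖fderiv ℝ ψ y‖ ≤ M)
    (hF : Measurable F) (hF0 : ∀ y, 0 ≤ F y) {b : ℝ} (hFb : ∀ y, F y ≤ b)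
    (hψF : ∀ y, ‖fderiv ℝ ψ y‖ ^ 2 ≤ 8 * (4 * C) ^ 2 * W y ^ (2 * p) + F y) :
    ∫ y, ψ y ∂(Q (γ 1)) - ∫ y, ψ y ∂(Q (γ 0)) ≤
      2 * C * (∫ t in (0:ℝ)..1, W (γ t) ^ p * ‖deriv γ t‖) + B * ∫ y, F y ∂(pathMixture Q γ) := by
  obtain ⟨hdiff, hbound⟩ := hgrad ψ hψ ⟨1, hψ1⟩ hψM
  obtain ⟨hFi, hFeq⟩ := integral_integral_kernel_path Q hγ.continuous hF hF0 hFb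
  have hJ := intervalIntegrable_weight_mul_norm_deriv (p := p) hWc hW hγ
  obtain ⟨M, hM⟩ := hψM
  have hM0 : 0 ≤ M := (norm_nonneg _).trans (hM 0)
  have hFint (z) : Integrable F (Q z) := Integrable.of_bound hF.aestronglyMeasurable b
    (ae_of_all _ fun y => by rw [Real.norm_of_nonneg (hF0 y)]; exact hFb y)
  have hrhs : 2 * C * (∫ t in (0:ℝ)..1, W (γ t) ^ p * ‖deriv γ t‖) +
      B * ∫ y, F y ∂(pathMixture Q γ) =
      ∫ t in (0:ℝ)..1, (2 * C * (W (γ t) ^ p * ‖deriv γ t‖) + B * ∫ y, F y ∂(Q (γ t))) := by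
    rw [intervalIntegral.integral_add (hJ.const_mul _) (hFi.const_mul _),
      intervalIntegral.integral_const_mul, intervalIntegral.integral_const_mul, hFeq, pathMixture]
  rw [hrhs]
  refine sub_le_integral_of_norm_fderiv_le (A := fun z => W z * (e * M + C * 1)) hdiff
    (by fun_prop) (fun z => (hbound z).trans ?_) hγ ((hJ.const_mul _).add (hFi.const_mul _))
    fun t ht => ?_
  · have hWz := zero_le_one.trans (hW z)
    have h1 : ⨆ y, |ψ y| ≤ 1 := ciSup_le hψ1
    have h2 : √(∫ y, ‖fderiv ℝ ψ y‖ ^ 2 ∂(Q z)) ≤ M := by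
      refine Real.sqrt_le_iff.2 ⟨hM0, ?_⟩
      calc ∫ y, ‖fderiv ℝ ψ y‖ ^ 2 ∂(Q z) ≤ ∫ _, M ^ 2 ∂(Q z) :=
            integral_mono_of_nonneg (ae_of_all _ fun _ => sq_nonneg _) (integrable_const _)
              (ae_of_all _ fun y => pow_le_pow_left₀ (norm_nonneg _) (hM y) 2)
        _ = M ^ 2 := by simp
    gcongr
  · have h1 := norm_fderiv_integral_kernel_le hWc hW hp hC hCt he heC (γ t) (hbound (γ t))
      (hsuper (γ t)) hψ1 (hFint _) hF0 hψF
    have hI : 0 ≤ ∫ y, F y ∂(Q (γ t)) := integral_nonneg hF0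
    calc _ ≤ (2 * C * W (γ t) ^ p + (4 * C)⁻¹ * W (γ t) * ∫ y, F y ∂(Q (γ t))) *
          ‖deriv γ t‖ := by gcongr
      _ = 2 * C * (W (γ t) ^ p * ‖deriv γ t‖) +
          (4 * C)⁻¹ * W (γ t) * ‖deriv γ t‖ * ∫ y, F y ∂(Q (γ t)) := by ring
      _ ≤ _ := by
          gcongr
          exact hB t ht

/-- The action of `Q` on the slope class, up to an error controlled by the penalty. -/
theorem integral_sub_le_of_mem_slopeClass (hWc : Continuous W) (hW : ∀ z, 1 ≤ W z) (hp : 1 < p)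
    (hC : 0 < C) (hCt : 0 < Ct) (he : 0 ≤ e) (heC : e * (3 * √Ct + 1) ≤ 1 / 4)
    (hgrad : GradientBound Q W e C)
    (hsuper : ∀ x, ∫⁻ y, ENNReal.ofReal (W y ^ (2 * p)) ∂(Q x)
      ≤ ENNReal.ofReal (Ct * W x ^ (2 * p - 2)))
    {γ : ℝ → H} {L : ℝ≥0} (hγ : LipschitzWith L γ) {B : ℝ} (hB0 : 0 ≤ B)
    (hB : ∀ t ∈ Set.Icc (0:ℝ) 1, (4 * C)⁻¹ * W (γ t) * ‖deriv γ t‖ ≤ B)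
    {K : ℕ → Set H} {n : ℕ} {η : ℝ} (hη : 0 < η)
    (hK : ∫ z, penalty K n z ^ 2 ∂(pathMixture Q γ + Q (γ 0) + Q (γ 1)) ≤ η) {φ : H → ℝ}
    (hφ : φ ∈ slopeClass (penalizedWeight W p K n) (4 * C)) :
    ∫ y, φ y ∂(Q (γ 1)) - ∫ y, φ y ∂(Q (γ 0)) ≤
      2 * C * (∫ t in (0:ℝ)..1, W (γ t) ^ p * ‖deriv γ t‖) +
        (B * (8 * (4 * C) ^ 2 + 1) + 1) * η := by
  have hp0 : 0 ≤ p := by linarith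
  have hκ : 0 < 4 * C := by positivity
  obtain ⟨ψ, hψ, hψ1, hψM, hψφ, h, hhm, hh0, ⟨b, hhb⟩, hhl, hψh⟩ :=
    exists_smooth_approx (continuous_penalizedWeight hWc hp0 K n)
      (one_le_penalizedWeight hW hp0 K n) (penalizedWeight_le hW hp0 K n) hκ hφ
      (pathMixture Q γ + Q (γ 0) + Q (γ 1)) hη
  have hφm : Measurable φ := (slopeClass.lipschitz hκ.le
    (zero_le_one.trans ((one_le_penalizedWeight hW hp0 K n 0).trans
      (penalizedWeight_le hW hp0 K n 0))) hφ
    (penalizedWeight_le hW hp0 K n)).continuous.measurable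
  have hψi (m : Measure H) [IsFiniteMeasure m] : Integrable ψ m :=
    Integrable.of_bound hψ.continuous.aestronglyMeasurable 1 (ae_of_all _ hψ1)
  have hφi (m : Measure H) [IsFiniteMeasure m] : Integrable φ m :=
    Integrable.of_bound hφm.aestronglyMeasurable 1
      (ae_of_all _ fun y => abs_le.2 ⟨by linarith [hφ.1 y], hφ.2.1 y⟩)
  have hdi (m : Measure H) [IsFiniteMeasure m] : Integrable (fun x => |ψ x - φ x|) m :=
    ((hψi m).sub (hφi m)).abs
  have hhi (m : Measure H) [IsFiniteMeasure m] : Integrable h m :=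
    Integrable.of_bound hhm.aestronglyMeasurable b
      (ae_of_all _ fun y => by rw [Real.norm_of_nonneg (hh0 y)]; exact hhb y)
  have hpc := continuous_penalty K n
  have hpb (z : H) : penalty K n z ^ 2 ≤ ((n : ℝ) ^ 2) ^ 2 :=
    pow_le_pow_left₀ (penalty_nonneg K n z) (penalty_le K n z) 2
  have hpi (m : Measure H) [IsFiniteMeasure m] : Integrable (fun z => penalty K n z ^ 2) m :=
    Integrable.of_bound (hpc.pow 2).aestronglyMeasurable (((n : ℝ) ^ 2) ^ 2)
      (ae_of_all _ fun y => by rw [Real.norm_of_nonneg (sq_nonneg _)]; exact hpb y)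
  have hmain := integral_sub_le_of_gradientBound (F := fun z => 8 * (4 * C) ^ 2 *
      penalty K n z ^ 2 + h z) (b := 8 * (4 * C) ^ 2 * ((n : ℝ) ^ 2) ^ 2 + b)
    hWc hW hp hC hCt he heC hgrad hsuper hγ hB hψ hψ1 hψM
    (((hpc.pow 2).measurable.const_mul _).add hhm)
    (fun z => add_nonneg (by positivity) (hh0 z))
    (fun z => add_le_add (mul_le_mul_of_nonneg_left (hpb z) (by positivity)) (hhb z))
    fun z => by
      have h1 := penalizedWeight_sq_le hW hp0 K n z
      have h2 := mul_le_mul_of_nonneg_left h1 (by positivity : 0 ≤ 4 * (4 * C) ^ 2)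
      linarith [hψh z]
  rw [integral_add ((hpi _).const_mul _) (hhi _), integral_const_mul] at hmain
  rw [integral_add_measure (hhi _) (hhi _), integral_add_measure (hhi _) (hhi _)] at hhl
  rw [integral_add_measure (hpi _) (hpi _), integral_add_measure (hpi _) (hpi _)] at hK
  rw [integral_add_measure (hdi _) (hdi _), integral_add_measure (hdi _) (hdi _)] at hψφ
  have hh2 (m : Measure H) : 0 ≤ ∫ z, h z ∂m := integral_nonneg hh0
  have hp2 (m : Measure H) : 0 ≤ ∫ z, penalty K n z ^ 2 ∂m := integral_nonneg fun _ => sq_nonneg _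
  have hd0 : 0 ≤ ∫ z, |ψ z - φ z| ∂(pathMixture Q γ) := integral_nonneg fun _ => abs_nonneg _
  have hh1 : ∫ z, h z ∂(pathMixture Q γ) ≤ η := by linarith [hh2 (Q (γ 0)), hh2 (Q (γ 1))]
  have hp1 : ∫ z, penalty K n z ^ 2 ∂(pathMixture Q γ) ≤ η := by
    linarith [hp2 (Q (γ 0)), hp2 (Q (γ 1))]
  have hd (x : H) : |∫ y, ψ y ∂(Q x) - ∫ y, φ y ∂(Q x)| ≤ ∫ y, |ψ y - φ y| ∂(Q x) := by
    rw [← integral_sub (hψi _) (hφi _)]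
    exact abs_integral_le_integral_abs
  have hlast : B * (8 * (4 * C) ^ 2 * ∫ z, penalty K n z ^ 2 ∂(pathMixture Q γ) +
      ∫ z, h z ∂(pathMixture Q γ)) ≤ B * (8 * (4 * C) ^ 2 * η + η) := by gcongr
  linarith [abs_le.1 (hd (γ 0)), abs_le.1 (hd (γ 1))]

/-- The contraction estimate along a path. -/
theorem liftDist_le_of_path (hWc : Continuous W) (hW : ∀ z, 1 ≤ W z) (hp : 1 < p)
    (hC : 0 < C) (hCt : 0 < Ct) (he : 0 ≤ e) (heC : e * (3 * √Ct + 1) ≤ 1 / 4)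
    (hgrad : GradientBound Q W e C)
    (hsuper : ∀ x, ∫⁻ y, ENNReal.ofReal (W y ^ (2 * p)) ∂(Q x)
      ≤ ENNReal.ofReal (Ct * W x ^ (2 * p - 2)))
    {γ : ℝ → H} {L : ℝ≥0} (hγ : LipschitzWith L γ) {ε : ℝ} (hε : 0 < ε) :
    liftDist (fun a b => min 1 (4 * C * rhoP W p a b)) (Q (γ 0)) (Q (γ 1)) ≤
      ENNReal.ofReal (2 * C * (∫ t in (0:ℝ)..1, W (γ t) ^ p * ‖deriv γ t‖) + ε) := by
  have hp0 : 0 ≤ p := by linarith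
  have hκ : 0 < 4 * C := by positivity
  obtain ⟨B, hB0, hB⟩ : ∃ B : ℝ, 0 ≤ B ∧
      ∀ t ∈ Set.Icc (0:ℝ) 1, (4 * C)⁻¹ * W (γ t) * ‖deriv γ t‖ ≤ B := by
    obtain ⟨b, hb⟩ := isCompact_Icc.exists_bound_of_continuousOn (s := Set.Icc (0:ℝ) 1)
      (hWc.comp hγ.continuous).continuousOn
    have hb0 : 0 ≤ b := (norm_nonneg _).trans (hb 0 (by simp))
    refine ⟨(4 * C)⁻¹ * b * L, by positivity, fun t ht => ?_⟩
    have h1 : W (γ t) ≤ b := (Real.le_norm_self _).trans (hb t ht)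
    have h2 : ‖deriv γ t‖ ≤ L := norm_deriv_le_of_lipschitz hγ
    gcongr
  set J := ∫ t in (0:ℝ)..1, W (γ t) ^ p * ‖deriv γ t‖
  have hJ : 0 ≤ J := intervalIntegral.integral_nonneg zero_le_one fun t _ =>
    mul_nonneg (Real.rpow_nonneg (zero_le_one.trans (hW _)) _) (norm_nonneg _)
  set A := B * (8 * (4 * C) ^ 2 + 1) + 1
  have hA : 0 < A := by positivity
  set η := ε / (A + 2)
  have hη : 0 < η := by positivity
  have hηε : A * η + η + η = ε := by
    simp only [η]
    field_simp
    ring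
  obtain ⟨K, hKc, hK0, hKm, hKp⟩ :=
    exists_compacts_penalty_le (pathMixture Q γ + Q (γ 0) + Q (γ 1)) hη
  obtain ⟨n, hn⟩ := exists_slopeClass_rhoP_le hWc hW hp0 hKc hK0 hκ
  obtain ⟨c, hc, hcm, π, hπ, hπc⟩ := exists_coupling_of_slopeClass_bound (Q (γ 0)) (Q (γ 1))
    (fun z => zero_le_one.trans (one_le_penalizedWeight hW hp0 K n z))
    (penalizedWeight_le hW hp0 K n) hκ.le _
    (fun φ hφ => integral_sub_le_of_mem_slopeClass hWc hW hp hC hCt he heC hgrad hsuper hγ hB0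
      hB hη (hKp n) hφ) hη
  have hKmeas : MeasurableSet (K 0)ᶜ := (hKc 0).isClosed.measurableSet.compl
  have hKπ : π (Prod.fst ⁻¹' (K 0)ᶜ) ≤ ENNReal.ofReal η := by
    rw [← Measure.map_apply measurable_fst hKmeas, hπ.1]
    calc Q (γ 0) (K 0)ᶜ ≤ (pathMixture Q γ + Q (γ 0) + Q (γ 1)) (K 0)ᶜ := by
          simp only [Measure.add_apply]
          exact (self_le_add_left _ _).trans (self_le_add_right _ _)
      _ = ENNReal.ofReal ((pathMixture Q γ + Q (γ 0) + Q (γ 1)).real (K 0)ᶜ) := by simp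
      _ ≤ ENNReal.ofReal η := ENNReal.ofReal_le_ofReal hKm
  have hpoint (q : H × H) : ENNReal.ofReal (min 1 (4 * C * rhoP W p q.1 q.2)) ≤
      ENNReal.ofReal (c q.1 q.2) + (Prod.fst ⁻¹' (K 0)ᶜ).indicator 1 q := by
    by_cases hq : q.1 ∈ K 0
    · obtain ⟨f, hf, hfa, hfb⟩ := hn q.1 hq
      refine le_add_right (ENNReal.ofReal_le_ofReal ((hfb q.2).trans ?_))
      simpa [hfa] using hc f hf q.1 q.2
    · refine le_add_left ?_
      rw [Set.indicator_of_mem (by exact hq), Pi.one_apply, ENNReal.ofReal_le_one]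
      exact min_le_left _ _
  calc liftDist (fun a b => min 1 (4 * C * rhoP W p a b)) (Q (γ 0)) (Q (γ 1))
      ≤ ∫⁻ q, ENNReal.ofReal (min 1 (4 * C * rhoP W p q.1 q.2)) ∂π := sInf_le ⟨π, hπ, rfl⟩
    _ ≤ ∫⁻ q, (ENNReal.ofReal (c q.1 q.2) + (Prod.fst ⁻¹' (K 0)ᶜ).indicator 1 q) ∂π :=
        lintegral_mono hpoint
    _ = ∫⁻ q, ENNReal.ofReal (c q.1 q.2) ∂π + π (Prod.fst ⁻¹' (K 0)ᶜ) := by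
        rw [lintegral_add_left hcm.ennreal_ofReal, lintegral_indicator_one (measurable_fst hKmeas)]
    _ ≤ ENNReal.ofReal (2 * C * J + A * η + η) + ENNReal.ofReal η := add_le_add hπc hKπ
    _ = ENNReal.ofReal (2 * C * J + ε) := by
        rw [← ENNReal.ofReal_add (by positivity) hη.le, ← hηε]
        ring_nf

end PathEstimates

/-- A number above the weighted path metric is above the weighted length of some path. -/
theorem exists_path_lt_of_rhoP_lt {H : Type*} [NormedAddCommGroup H] [NormedSpace ℝ H]
    {W : H → ℝ} {p : ℝ} {x y : H} {r : ℝ} (hr : rhoP W p x y < r) :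
    ∃ γ : ℝ → H, (∃ K : ℝ≥0, LipschitzWith K γ) ∧ γ 0 = x ∧ γ 1 = y ∧
      ∫ t in (0:ℝ)..1, W (γ t) ^ p * ‖deriv γ t‖ < r := by
  have key := fun hne => exists_lt_of_csInf_lt hne hr
  obtain ⟨_, ⟨γ, hγ, h0, h1, rfl⟩, hlt⟩ := key
    ⟨_, AffineMap.lineMap x y, ⟨_, lipschitzWith_lineMap x y⟩, by simp, by simp, rfl⟩
  exact ⟨γ, hγ, h0, h1, hlt⟩

/-- **Proposition 5.5.** For a Markov semigroup on a separable Hilbert space satisfying the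
gradient bound `‖D P_t φ‖ ≤ W (e^{-γ̃ t} √(P_t ‖Dφ‖²) + C ‖φ‖_∞)` and the super-Lyapunov
bound `P_t W^{2p} ≤ C̃ W^{2p-2}` for `t ≥ t★`, there exist `δ > 0` and `T > 0` such that
`d(X,Y) = 1 ∧ δ⁻¹ ρ_p(X,Y)` is contracting for `P_T`. -/
theorem stmt_11 {H : Type*} [NormedAddCommGroup H] [InnerProductSpace ℝ H]
    [CompleteSpace H] [SecondCountableTopology H] [MeasurableSpace H] [BorelSpace H]
    (P : ℝ≥0 → Kernel H H) [∀ t, IsMarkovKernel (P t)]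
    (hsemi : ∀ s t : ℝ≥0, P (s + t) = (P t) ∘ₖ (P s))
    (W : H → ℝ) (hWcont : Continuous W) (hW_ge_one : ∀ x, 1 ≤ W x)
    (γt C : ℝ) (hγt : 0 < γt) (hC : 0 < C)
    -- the gradient bound
    (hgrad : ∀ φ : H → ℝ, ContDiff ℝ 1 φ → (∃ M, ∀ x, |φ x| ≤ M) →
      (∃ M, ∀ x, ‖fderiv ℝ φ x‖ ≤ M) → ∀ t : ℝ≥0,
      Differentiable ℝ (fun x => ∫ y, φ y ∂((P t) x)) ∧
      ∀ x : H, ‖fderiv ℝ (fun z => ∫ y, φ y ∂((P t) z)) x‖ ≤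
        W x * (Real.exp (-γt * t) * Real.sqrt (∫ y, ‖fderiv ℝ φ y‖ ^ 2 ∂((P t) x))
          + C * (⨆ z : H, |φ z|)))
    -- the super-Lyapunov bound
    (p : ℝ) (hp : 1 < p) (tstar : ℝ≥0) (htstar : 0 < tstar) (Ct : ℝ) (hCt : 0 < Ct)
    (hsuper : ∀ t : ℝ≥0, tstar ≤ t → ∀ x : H,
      ∫⁻ y, ENNReal.ofReal (W y ^ (2 * p)) ∂((P t) x)
        ≤ ENNReal.ofReal (Ct * W x ^ (2 * p - 2))) :
    ∃ δ : ℝ, 0 < δ ∧ ∃ T : ℝ≥0, 0 < T ∧ ∃ α : ℝ, α < 1 ∧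
      ∀ x y : H, min 1 (δ⁻¹ * rhoP W p x y) < 1 →
        liftDist (fun a b => min 1 (δ⁻¹ * rhoP W p a b)) ((P T) x) ((P T) y)
          ≤ ENNReal.ofReal (α * min 1 (δ⁻¹ * rhoP W p x y)) := by
  obtain ⟨s, hs⟩ : ∃ s : ℕ, Real.exp (-γt * s) * (3 * √Ct + 1) ≤ 1 / 4 := by
    have h1 : Tendsto (fun s : ℕ => Real.exp (-γt * s) * (3 * √Ct + 1)) atTop (𝓝 0) := by
      rw [← zero_mul (3 * √Ct + 1)]
      refine (Real.tendsto_exp_atBot.comp ?_).mul_const _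
      exact tendsto_natCast_atTop_atTop.const_mul_atTop_of_neg (by linarith)
    exact (h1.eventually (ge_mem_nhds (by norm_num : (0:ℝ) < 1 / 4))).exists
  set T : ℝ≥0 := tstar + s
  have hTs : tstar ≤ T := self_le_add_right _ _
  have hT : Real.exp (-γt * T) * (3 * √Ct + 1) ≤ 1 / 4 := by
    refine le_trans (mul_le_mul_of_nonneg_right (Real.exp_le_exp.2 ?_) (by positivity)) hs
    have : (s : ℝ) ≤ T := by simp [T]
    nlinarith
  refine ⟨(4 * C)⁻¹, by positivity, T, htstar.trans_le hTs, 1 / 2, by norm_num, fun x y hxy => ?_⟩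
  simp only [inv_inv] at hxy ⊢
  have hxy' : 4 * C * rhoP W p x y ≤ 1 := by
    by_contra! h
    rw [min_eq_left h.le] at hxy
    exact lt_irrefl _ hxy
  rw [min_eq_right hxy']
  refine ENNReal.le_of_forall_pos_le_add fun ε hε _ => ?_
  have hε' : (0 : ℝ) < ε := hε
  obtain ⟨γ, ⟨L, hγ⟩, h0, h1, hJ⟩ := exists_path_lt_of_rhoP_lt
    (lt_add_of_pos_right (rhoP W p x y) (by positivity : 0 < ε / (4 * C)))
  have h := liftDist_le_of_path hWcont hW_ge_one hp hC hCt (Real.exp_nonneg _) hT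
    (fun φ h1 h2 h3 => hgrad φ h1 h2 h3 T) (hsuper T hTs) hγ (half_pos hε')
  rw [h0, h1] at h
  refine h.trans ?_
  rw [← ENNReal.ofReal_coe_nnreal]
  refine (ENNReal.ofReal_le_ofReal ?_).trans ENNReal.ofReal_add_le
  calc _ ≤ 2 * C * (rhoP W p x y + ε / (4 * C)) + ε / 2 := by gcongr
    _ = _ := by
      field_simp
      ring
end
end
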